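/- Let k and u₀ be real and fix α with 0 ≤ α < 2π. Then there exist constants T₁ and C > 0 such that for every T ≥ T₁ the set S(α, u₀, V_k) ∩ (−∞, T) is finite and its cardinality N(T) satisfies |N(T) − ((1/(2π))·√T·log T + (1/π)·(2·log 2 − 1 − u₀)·√T)| ≤ C. -/

import Mathlib

/-- The Morse potential `V_k(u) = (1/4)·exp(2u) + k·exp(u)`. -/
noncomputable def morse (k u : ℝ) : ℝ := (1/4) * Real.exp (2*u) + k * Real.exp u

open MeasureTheory in
/-- The set of eigenvalues of the Schrödinger operator `-d²/du² + V` on `[u₀,∞)`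
with boundary condition `cos α · ψ(u₀) + sin α · ψ'(u₀) = 0`. -/
def evSet (α u₀ : ℝ) (V : ℝ → ℝ) : Set ℝ :=
  {E | ∃ ψ : ℝ → ℝ,
    (∀ u, DifferentiableAt ℝ ψ u) ∧ (∀ u, DifferentiableAt ℝ (deriv ψ) u) ∧
    (∃ u, u₀ ≤ u ∧ ψ u ≠ 0) ∧
    IntegrableOn (fun u => (ψ u)^2) (Set.Ici u₀) ∧
    (∀ u, u₀ ≤ u → -(deriv (deriv ψ) u) + V u * ψ u = E * ψ u) ∧
    Real.cos α * ψ u₀ + Real.sin α * deriv ψ u₀ = 0}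

namespace Morse9

open Set Filter Topology MeasureTheory

lemma sin_sq_sub (a b : ℝ) :
    Real.sin a ^ 2 - Real.sin b ^ 2 = Real.sin (a + b) * Real.sin (a - b) := by
  rw [Real.sin_add, Real.sin_sub]
  have h1 := Real.sin_sq_add_cos_sq a
  have h2 := Real.sin_sq_add_cos_sq b
  have e1 : Real.cos a ^ 2 = 1 - Real.sin a ^ 2 := by linarith
  have e2 : Real.cos b ^ 2 = 1 - Real.sin b ^ 2 := by linarith
  ring_nf
  rw [e1, e2]; ring

lemma abs_sin_sq_sub_le (a b : ℝ) :
    |Real.sin a ^ 2 - Real.sin b ^ 2| ≤ |a - b| := by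
  rw [sin_sq_sub, abs_mul]
  have h1 := Real.abs_sin_le_one (a + b)
  have h2 : |Real.sin (a - b)| ≤ |a - b| := Real.abs_sin_le_abs
  nlinarith [abs_nonneg (Real.sin (a + b)), abs_nonneg (Real.sin (a - b))]

lemma sin_eq_mul_sinc (x : ℝ) : Real.sin x = x * Real.sinc x := by
  by_cases h : x = 0
  · simp [h]
  · rw [Real.sinc_of_ne_zero h]; field_simp

/-- Linear differential inequality. -/
lemma lin_le {D D' m : ℝ → ℝ} {a b : ℝ} (hab : a ≤ b) (hm : Continuous m)
    (hD : ∀ u ∈ Icc a b, HasDerivAt D (D' u) u)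
    (hle : ∀ u ∈ Icc a b, D' u ≤ m u * D u) (h0 : D a ≤ 0) : D b ≤ 0 := by
  set M : ℝ → ℝ := fun u => ∫ t in a..u, m t
  have hM : ∀ u, HasDerivAt M (m u) u := fun u =>
    intervalIntegral.integral_hasDerivAt_right (hm.intervalIntegrable _ _)
      (hm.stronglyMeasurableAtFilter _ _) hm.continuousAt
  have hF : ∀ u ∈ Icc a b, HasDerivAt (fun u => D u * Real.exp (-M u))
      (D' u * Real.exp (-M u) + D u * (Real.exp (-M u) * (-m u))) u := fun u hu =>
    (hD u hu).mul ((hM u).neg.exp)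
  have hanti : AntitoneOn (fun u => D u * Real.exp (-M u)) (Icc a b) := by
    apply antitoneOn_of_deriv_nonpos (convex_Icc a b)
    · exact fun u hu => (hF u hu).continuousAt.continuousWithinAt
    · exact fun u hu => (hF u (interior_subset hu)).differentiableAt.differentiableWithinAt
    · intro u hu
      rw [(hF u (interior_subset hu)).deriv]
      have := hle u (interior_subset hu)
      have hp := Real.exp_pos (-M u)
      nlinarith
  have h := hanti (left_mem_Icc.2 hab) (right_mem_Icc.2 hab) hab
  have hMa : M a = 0 := by simp [M]
  simp only [hMa, neg_zero, Real.exp_zero, mul_one] at h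
  have hp := Real.exp_pos (-M b)
  by_contra hc
  push Not at hc
  have := mul_pos hc hp
  linarith

/-- Comparison for the Prüfer equation. -/
lemma prufer_le {Q θ₁ θ₂ d₁ d₂ : ℝ → ℝ} {a b : ℝ} (hab : a ≤ b) (hQ : Continuous Q)
    (hc₁ : Continuous θ₁) (hc₂ : Continuous θ₂)
    (h₁ : ∀ u ∈ Icc a b, HasDerivAt θ₁ (d₁ u) u) (h₂ : ∀ u ∈ Icc a b, HasDerivAt θ₂ (d₂ u) u)
    (hd₁ : ∀ u ∈ Icc a b, d₁ u ≤ 1 + (Q u - 1) * Real.sin (θ₁ u) ^ 2)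
    (hd₂ : ∀ u ∈ Icc a b, 1 + (Q u - 1) * Real.sin (θ₂ u) ^ 2 ≤ d₂ u)
    (h0 : θ₁ a ≤ θ₂ a) : θ₁ b ≤ θ₂ b := by
  have := lin_le (D := fun u => θ₁ u - θ₂ u) (D' := fun u => d₁ u - d₂ u)
    (m := fun u => (Q u - 1) * Real.sin (θ₁ u + θ₂ u) * Real.sinc (θ₁ u - θ₂ u)) hab
    (by have := Real.continuous_sinc; fun_prop) (fun u hu => (h₁ u hu).sub (h₂ u hu)) (by
      intro u hu
      have e := sin_sq_sub (θ₁ u) (θ₂ u)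
      rw [sin_eq_mul_sinc (θ₁ u - θ₂ u)] at e
      have h3 := hd₁ u hu
      have h4 := hd₂ u hu
      calc d₁ u - d₂ u ≤ (Q u - 1) * (Real.sin (θ₁ u) ^ 2 - Real.sin (θ₂ u) ^ 2) := by linarith
        _ = _ := by rw [e]; ring) (by simpa using h0)
  simpa using this

/-- Global existence for the Prüfer equation. -/
lemma prufer_exists_Icc (Q : ℝ → ℝ) (hQ : Continuous Q) (u₀ θ₀ : ℝ) (R : ℝ) (hR : 0 < R) :
    ∃ θ : ℝ → ℝ, θ u₀ = θ₀ ∧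
      ∀ u ∈ Icc (u₀ - R) (u₀ + R),
        HasDerivWithinAt θ (1 + (Q u - 1) * Real.sin (θ u) ^ 2) (Icc (u₀ - R) (u₀ + R)) u := by
  obtain ⟨M, hM⟩ := isCompact_Icc.exists_bound_of_continuousOn (s := Icc (u₀ - R) (u₀ + R))
    (f := fun u => Q u - 1) (by fun_prop)
  have hM0 : 0 ≤ M := (norm_nonneg _).trans (hM u₀ ⟨by linarith, by linarith⟩)
  have key : IsPicardLindelof (fun u θ => 1 + (Q u - 1) * Real.sin θ ^ 2)
      (tmin := u₀ - R) (tmax := u₀ + R) ⟨u₀, by constructor <;> linarith⟩ θ₀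
      (⟨(1 + M) * R, by positivity⟩) 0 ⟨1 + M, by positivity⟩ ⟨M, hM0⟩ := by
    refine ⟨?_, ?_, ?_, ?_⟩
    · intro t ht
      apply LipschitzOnWith.of_dist_le_mul
      intro x _ y _
      simp only [Real.dist_eq]
      have : 1 + (Q t - 1) * Real.sin x ^ 2 - (1 + (Q t - 1) * Real.sin y ^ 2)
        = (Q t - 1) * (Real.sin x ^ 2 - Real.sin y ^ 2) := by ring
      rw [this, abs_mul]
      have h1 := hM t ht
      rw [Real.norm_eq_abs] at h1
      exact mul_le_mul h1 (abs_sin_sq_sub_le x y) (abs_nonneg _) hM0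
    · intro x _
      fun_prop
    · intro t ht x _
      have h1 := hM t ht
      rw [Real.norm_eq_abs] at h1
      simp only [Real.norm_eq_abs]
      have h2 : |Real.sin x ^ 2| ≤ 1 := by
        rw [abs_of_nonneg (sq_nonneg _)]; exact Real.sin_sq_le_one x
      calc |1 + (Q t - 1) * Real.sin x ^ 2| ≤ |1| + |(Q t - 1) * Real.sin x ^ 2| := abs_add_le _ _
        _ ≤ 1 + M * 1 := by
          rw [abs_one, abs_mul]
          gcongr
        _ = 1 + M := by ring
    · simp only [add_sub_cancel_left, sub_sub_cancel, max_self, NNReal.coe_zero, sub_zero]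
      exact le_refl ((1 + M) * R)
  obtain ⟨α, h0, h1⟩ := key.exists_eq_forall_mem_Icc_hasDerivWithinAt₀
  exact ⟨α, h0, h1⟩

lemma prufer_exists (Q : ℝ → ℝ) (hQ : Continuous Q) (u₀ θ₀ : ℝ) :
    ∃ θ : ℝ → ℝ, θ u₀ = θ₀ ∧
      ∀ u, HasDerivAt θ (1 + (Q u - 1) * Real.sin (θ u) ^ 2) u := by
  have h := fun n : ℕ => prufer_exists_Icc Q hQ u₀ θ₀ ((n : ℝ) + 1) (by positivity)
  choose θ h0 h1 using h
  have hd : ∀ n : ℕ, ∀ u ∈ Ioo (u₀ - (n + 1)) (u₀ + (n + 1)),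
      HasDerivAt (θ n) (1 + (Q u - 1) * Real.sin (θ n u) ^ 2) u := fun n u hu =>
    (h1 n u (Ioo_subset_Icc_self hu)).hasDerivAt (Icc_mem_nhds hu.1 hu.2)
  have heq : ∀ n m : ℕ, n ≤ m → EqOn (θ n) (θ m) (Ioo (u₀ - (n + 1)) (u₀ + (n + 1))) := by
    intro n m hnm
    have hnm' : (n : ℝ) ≤ m := by exact_mod_cast hnm
    obtain ⟨M, hM⟩ := isCompact_Icc.exists_bound_of_continuousOn
      (s := Icc (u₀ - ((n : ℝ) + 1)) (u₀ + (n + 1))) (f := fun u => Q u - 1) (by fun_prop)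
    have hn : (0 : ℝ) ≤ n := Nat.cast_nonneg n
    have hM0 : 0 ≤ M := (norm_nonneg _).trans (hM u₀ ⟨by linarith, by linarith⟩)
    apply ODE_solution_unique_of_mem_Ioo (v := fun u θ => 1 + (Q u - 1) * Real.sin θ ^ 2)
      (s := fun _ => univ) (K := ⟨M, hM0⟩) (t₀ := u₀)
    · intro t ht
      apply LipschitzOnWith.of_dist_le_mul
      intro x _ y _
      simp only [Real.dist_eq]
      have : 1 + (Q t - 1) * Real.sin x ^ 2 - (1 + (Q t - 1) * Real.sin y ^ 2)
        = (Q t - 1) * (Real.sin x ^ 2 - Real.sin y ^ 2) := by ring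
      rw [this, abs_mul]
      have h1 := hM t (Ioo_subset_Icc_self ht)
      rw [Real.norm_eq_abs] at h1
      exact mul_le_mul h1 (abs_sin_sq_sub_le x y) (abs_nonneg _) hM0
    · constructor <;> linarith
    · exact fun t ht => ⟨hd n t ht, mem_univ _⟩
    · exact fun t ht => ⟨hd m t ⟨by linarith [ht.1], by linarith [ht.2]⟩, mem_univ _⟩
    · rw [h0, h0]
  have hmem : ∀ u : ℝ, u ∈ Ioo (u₀ - ((⌈|u - u₀|⌉₊ : ℝ) + 1)) (u₀ + ((⌈|u - u₀|⌉₊ : ℝ) + 1)) := by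
    intro u
    have h1 := Nat.le_ceil (|u - u₀|)
    have h2 := le_abs_self (u - u₀)
    have h3 := neg_abs_le (u - u₀)
    constructor <;> linarith
  refine ⟨fun u => θ ⌈|u - u₀|⌉₊ u, by simp [h0], fun u => ?_⟩
  set n := ⌈|u - u₀|⌉₊ with hn
  have hev : (fun u => θ ⌈|u - u₀|⌉₊ u) =ᶠ[𝓝 u] θ n := by
    filter_upwards [Ioo_mem_nhds (hmem u).1 (hmem u).2] with v hv
    rcases le_total n ⌈|v - u₀|⌉₊ with h | h
    · exact (heq _ _ h hv).symm
    · exact heq _ _ h (hmem v)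
  exact (hd n u (hmem u)).congr_of_eventuallyEq hev

end Morse9

namespace Morse9

open Set Filter Topology MeasureTheory

/-- `θ` is a Prüfer angle for the potential `V` and energy `E`. -/
def IsPr (V : ℝ → ℝ) (E : ℝ) (θ : ℝ → ℝ) : Prop :=
  ∀ u, HasDerivAt θ (1 + ((E - V u) - 1) * Real.sin (θ u) ^ 2) u

lemma IsPr.continuous {V θ : ℝ → ℝ} {E : ℝ} (h : IsPr V E θ) : Continuous θ :=
  continuous_iff_continuousAt.2 fun u => (h u).continuousAt

lemma IsPr.mono {V θ θ' : ℝ → ℝ} {E E' a u : ℝ} (hV : Continuous V) (h : IsPr V E θ)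
    (h' : IsPr V E' θ') (hE : E ≤ E') (h0 : θ a ≤ θ' a) (hu : a ≤ u) : θ u ≤ θ' u := by
  refine prufer_le (Q := fun u => E - V u) hu (by fun_prop) h.continuous h'.continuous
    (fun u _ => h u) (fun u _ => h' u) (fun u _ => le_rfl) (fun u _ => ?_) h0
  have := sq_nonneg (Real.sin (θ' u))
  nlinarith

lemma sin_sq_int_mul_pi (j : ℤ) : Real.sin (j * Real.pi) ^ 2 = 0 := by
  rw [Real.sin_int_mul_pi]; simp

lemma sin_sq_half (j : ℤ) : Real.sin (j * Real.pi + Real.pi / 2) ^ 2 = 1 := by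
  rw [Real.sin_add_pi_div_two]
  have := Real.sin_sq_add_cos_sq (j * Real.pi)
  rw [sin_sq_int_mul_pi] at this
  linarith

lemma IsPr.barrier_up {V θ : ℝ → ℝ} {E a u : ℝ} (hV : Continuous V) (h : IsPr V E θ)
    (j : ℤ) (hE : ∀ u, a ≤ u → E ≤ V u) (h0 : θ a ≤ j * Real.pi + Real.pi / 2) (hu : a ≤ u) :
    θ u ≤ j * Real.pi + Real.pi / 2 := by
  refine prufer_le (Q := fun u => E - V u) (θ₂ := fun _ => j * Real.pi + Real.pi / 2)
    hu (by fun_prop) h.continuous continuous_const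
    (fun u _ => h u) (fun u _ => hasDerivAt_const _ _) (fun u _ => le_rfl) (fun u hu => ?_) h0
  rw [sin_sq_half]
  linarith [hE u hu.1]

lemma IsPr.barrier_low {V θ : ℝ → ℝ} {E a u : ℝ} (hV : Continuous V) (h : IsPr V E θ)
    (j : ℤ) (h0 : j * Real.pi ≤ θ a) (hu : a ≤ u) :
    j * Real.pi ≤ θ u := by
  refine prufer_le (Q := fun u => E - V u) (θ₁ := fun _ => j * Real.pi)
    hu (by fun_prop) continuous_const h.continuous
    (fun u _ => hasDerivAt_const _ _) (fun u _ => h u) (fun u hu => ?_) (fun u _ => le_rfl) h0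
  rw [sin_sq_int_mul_pi]
  linarith

lemma cont_E {V : ℝ → ℝ} (hV : Continuous V) {Θ : ℝ → ℝ → ℝ} (h : ∀ E, IsPr V E (Θ E))
    {u₀ θ₀ u : ℝ} (h0 : ∀ E, Θ E u₀ = θ₀) (hu : u₀ ≤ u) : Continuous fun E => Θ E u := by
  rw [continuous_iff_continuousAt]
  intro E
  obtain ⟨M, hM⟩ := isCompact_Icc.exists_bound_of_continuousOn
      (s := Icc u₀ u) (f := fun u => E - V u - 1) (by fun_prop)
  have hb : ∀ E', |Θ E' u - Θ E u| ≤ gronwallBound 0 M |E' - E| (u - u₀) := by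
    intro E'
    have := norm_le_gronwallBound_of_norm_deriv_right_le (f := fun v => Θ E' v - Θ E v)
      (f' := fun v => (1 + ((E' - V v) - 1) * Real.sin (Θ E' v) ^ 2) -
        (1 + ((E - V v) - 1) * Real.sin (Θ E v) ^ 2)) (δ := 0) (K := M) (ε := |E' - E|)
      (a := u₀) (b := u)
      ((h E').continuous.sub (h E).continuous).continuousOn
      (fun v _ => ((h E' v).sub (h E v)).hasDerivWithinAt) (by simp [h0]) (by
        intro v hv
        have h1 := hM v (Ico_subset_Icc_self hv)
        have e : (1 + ((E' - V v) - 1) * Real.sin (Θ E' v) ^ 2) -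
          (1 + ((E - V v) - 1) * Real.sin (Θ E v) ^ 2) =
          (E - V v - 1) * (Real.sin (Θ E' v) ^ 2 - Real.sin (Θ E v) ^ 2)
            + (E' - E) * Real.sin (Θ E' v) ^ 2 := by ring
        rw [e]
        refine (norm_add_le _ _).trans ?_
        rw [norm_mul, norm_mul]
        have h3 : ‖Real.sin (Θ E' v) ^ 2‖ ≤ 1 := by
          rw [Real.norm_of_nonneg (sq_nonneg _)]; exact Real.sin_sq_le_one _
        have h4 : ‖Real.sin (Θ E' v) ^ 2 - Real.sin (Θ E v) ^ 2‖ ≤ ‖Θ E' v - Θ E v‖ :=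
          abs_sin_sq_sub_le _ _
        have h5 : ‖E' - E‖ * ‖Real.sin (Θ E' v) ^ 2‖ ≤ |E' - E| * 1 :=
          mul_le_mul_of_nonneg_left h3 (abs_nonneg _)
        have h6 := mul_le_mul h1 h4 (norm_nonneg _) ((norm_nonneg _).trans h1)
        linarith)
    exact this u (right_mem_Icc.2 hu)
  have hlim : Tendsto (fun E' => gronwallBound 0 M |E' - E| (u - u₀)) (𝓝 E) (𝓝 0) := by
    have hc : Continuous fun E' => gronwallBound 0 M |E' - E| (u - u₀) :=
      (gronwallBound_continuous_ε 0 M (u - u₀)).comp (by fun_prop : Continuous fun E' => |E' - E|)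
    have := hc.tendsto E
    simpa [gronwallBound] using this
  rw [ContinuousAt, tendsto_iff_dist_tendsto_zero]
  exact squeeze_zero (fun _ => dist_nonneg) hb hlim

/-- Prüfer amplitude. -/
noncomputable def amp (V : ℝ → ℝ) (E : ℝ) (θ : ℝ → ℝ) (u : ℝ) : ℝ :=
  Real.exp (∫ t in (0:ℝ)..u, (1 + V t - E) * (Real.sin (θ t) * Real.cos (θ t)))

lemma amp_pos (V : ℝ → ℝ) (E : ℝ) (θ : ℝ → ℝ) (u : ℝ) : 0 < amp V E θ u := Real.exp_pos _

lemma amp_deriv {V θ : ℝ → ℝ} {E : ℝ} (hV : Continuous V) (h : IsPr V E θ) (u : ℝ) :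
    HasDerivAt (amp V E θ)
      (amp V E θ u * ((1 + V u - E) * (Real.sin (θ u) * Real.cos (θ u)))) u := by
  have hc := h.continuous
  have hm : Continuous fun t => (1 + V t - E) * (Real.sin (θ t) * Real.cos (θ t)) := by fun_prop
  exact (intervalIntegral.integral_hasDerivAt_right (hm.intervalIntegrable _ _)
      (hm.stronglyMeasurableAtFilter _ _) hm.continuousAt).exp

/-- The solution. -/
noncomputable def phi (V : ℝ → ℝ) (E : ℝ) (θ : ℝ → ℝ) (u : ℝ) : ℝ :=
  amp V E θ u * Real.sin (θ u)

/-- Its derivative. -/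
noncomputable def dphi (V : ℝ → ℝ) (E : ℝ) (θ : ℝ → ℝ) (u : ℝ) : ℝ :=
  amp V E θ u * Real.cos (θ u)

lemma phi_deriv {V θ : ℝ → ℝ} {E : ℝ} (hV : Continuous V) (h : IsPr V E θ) (u : ℝ) :
    HasDerivAt (phi V E θ) (dphi V E θ u) u := by
  have := (amp_deriv hV h u).mul (h u).sin
  refine this.congr_deriv ?_
  unfold dphi
  have e := Real.sin_sq_add_cos_sq (θ u)
  ring

lemma dphi_deriv {V θ : ℝ → ℝ} {E : ℝ} (hV : Continuous V) (h : IsPr V E θ) (u : ℝ) :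
    HasDerivAt (dphi V E θ) ((V u - E) * phi V E θ u) u := by
  have := (amp_deriv hV h u).mul (h u).cos
  refine this.congr_deriv ?_
  unfold phi
  have e := Real.cos_sq' (θ u)
  have : amp V E θ u * ((1 + V u - E) * (Real.sin (θ u) * Real.cos (θ u))) * Real.cos (θ u) +
    amp V E θ u * (-Real.sin (θ u) * (1 + (E - V u - 1) * Real.sin (θ u) ^ 2)) =
    amp V E θ u * ((1 + V u - E) * (Real.sin (θ u) * Real.cos (θ u)^2)) +
    amp V E θ u * (-Real.sin (θ u) * (1 + (E - V u - 1) * Real.sin (θ u) ^ 2)) := by ring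
  rw [this, e]; ring

lemma const_of_deriv_zero {f : ℝ → ℝ} {a : ℝ} (h : ∀ u, a ≤ u → HasDerivAt f 0 u) {u : ℝ}
    (hu : a ≤ u) : f u = f a :=
  constant_of_has_deriv_right_zero (a := a) (b := u)
    (fun x hx => (h x hx.1).continuousAt.continuousWithinAt)
    (fun x hx => (h x hx.1).hasDerivWithinAt) u (right_mem_Icc.2 hu)

lemma ev_iff {V θ : ℝ → ℝ} {E α u₀ : ℝ} (hV : Continuous V) (h : IsPr V E θ)
    (h0 : θ u₀ = -α) :
    E ∈ evSet α u₀ V ↔ IntegrableOn (fun u => phi V E θ u ^ 2) (Ici u₀) := by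
  have hd : deriv (phi V E θ) = dphi V E θ := funext fun u => (phi_deriv hV h u).deriv
  constructor
  · rintro ⟨ψ, h1, h2, ⟨v, hv, hne⟩, hsqInt, hode, hbc⟩
    -- the two Wronskian-type quantities
    have hψ : ∀ u, HasDerivAt ψ (deriv ψ u) u := fun u => (h1 u).hasDerivAt
    have hψ' : ∀ u, u₀ ≤ u → HasDerivAt (deriv ψ) ((V u - E) * ψ u) u := fun u hu => by
      have := (h2 u).hasDerivAt
      refine this.congr_deriv ?_
      linarith [hode u hu]
    have hW : ∀ u, u₀ ≤ u → ψ u * dphi V E θ u - deriv ψ u * phi V E θ u = 0 := by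
      intro u hu
      have := const_of_deriv_zero (f := fun u => ψ u * dphi V E θ u - deriv ψ u * phi V E θ u)
        (a := u₀) (fun w hw => (((hψ w).mul (dphi_deriv hV h w)).sub
          ((hψ' w hw).mul (phi_deriv hV h w))).congr_deriv (by ring)) hu
      rw [this]
      unfold phi dphi
      rw [h0, Real.sin_neg, Real.cos_neg]
      linear_combination (amp V E θ u₀) * hbc
    have hA : ∀ u, amp V E θ u ≠ 0 := fun u => (amp_pos V E θ u).ne'
    have hρ : ∀ u, u₀ ≤ u → ψ u * Real.cos (θ u) = deriv ψ u * Real.sin (θ u) := by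
      intro u hu
      have := hW u hu
      unfold phi dphi at this
      have h3 : amp V E θ u * (ψ u * Real.cos (θ u) - deriv ψ u * Real.sin (θ u)) = 0 := by
        linear_combination this
      rcases mul_eq_zero.1 h3 with h4 | h4
      · exact absurd h4 (hA u)
      · linarith
    -- ψ = K φ
    set K : ℝ → ℝ := fun u => (ψ u * Real.sin (θ u) + deriv ψ u * Real.cos (θ u)) / amp V E θ u
    have hK : ∀ u, u₀ ≤ u → ψ u = K u * phi V E θ u := by
      intro u hu
      have e := Real.sin_sq_add_cos_sq (θ u)
      have e2 := hρ u hu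
      have := hA u
      simp only [K, phi]
      field_simp
      linear_combination (-ψ u) * e + Real.cos (θ u) * e2
    have hKc : ∀ u, u₀ ≤ u → K u = K u₀ := by
      intro u hu
      refine const_of_deriv_zero (f := K) (a := u₀) (fun w hw => ?_) hu
      have := (((hψ w).mul (h w).sin).add ((hψ' w hw).mul (h w).cos)).div (amp_deriv hV h w) (hA w)
      refine this.congr_deriv ?_
      have e := Real.sin_sq_add_cos_sq (θ w)
      have e2 := hρ w hw
      have e3 := hA w
      rw [div_eq_zero_iff]
      left
      simp only [Pi.add_apply, Pi.mul_apply]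
      have e4 : Real.cos (θ w) ^ 2 = 1 - Real.sin (θ w) ^ 2 := by linarith
      have : (deriv ψ w * Real.sin (θ w) +
        ψ w * (Real.cos (θ w) * (1 + (E - V w - 1) * Real.sin (θ w) ^ 2)) +
        ((V w - E) * ψ w * Real.cos (θ w) +
          deriv ψ w * (-Real.sin (θ w) * (1 + (E - V w - 1) * Real.sin (θ w) ^ 2)))) * amp V E θ w -
        (ψ w * Real.sin (θ w) + deriv ψ w * Real.cos (θ w)) *
          (amp V E θ w * ((1 + V w - E) * (Real.sin (θ w) * Real.cos (θ w)))) =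
        amp V E θ w * ((1 + V w - E) * (ψ w * Real.cos (θ w) *(1 - Real.sin (θ w)^2 ) +
          deriv ψ w * Real.sin (θ w)^3 - ψ w * Real.sin (θ w)^2 * Real.cos (θ w) -
          deriv ψ w * Real.sin (θ w) * Real.cos (θ w)^2)) := by ring
      rw [this, e4]
      have : (ψ w * Real.cos (θ w) *(1 - Real.sin (θ w)^2 ) +
          deriv ψ w * Real.sin (θ w)^3 - ψ w * Real.sin (θ w)^2 * Real.cos (θ w) -
          deriv ψ w * Real.sin (θ w) * (1 - Real.sin (θ w) ^ 2)) = 0 := by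
        linear_combination (1 - 2 * Real.sin (θ w)^2) * e2
      rw [this]; ring
    have hK0 : K u₀ ≠ 0 := by
      intro hk
      apply hne
      rw [hK v hv, hKc v hv, hk, zero_mul]
    have hcongr : EqOn (fun u => (K u₀)⁻¹ ^ 2 * ψ u ^ 2) (fun u => phi V E θ u ^ 2) (Ici u₀) := by
      intro u hu
      simp only
      rw [hK u hu, hKc u hu]
      field_simp
    exact IntegrableOn.congr_fun (hsqInt.const_mul ((K u₀)⁻¹ ^ 2)) hcongr measurableSet_Ici
  · intro hsqInt
    refine ⟨phi V E θ, fun u => (phi_deriv hV h u).differentiableAt, ?_, ?_, hsqInt, ?_, ?_⟩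
    · rw [hd]; exact fun u => (dphi_deriv hV h u).differentiableAt
    · by_contra hc
      push Not at hc
      have h3 : ∀ u, u₀ ≤ u → Real.sin (θ u) = 0 := fun u hu => by
        have := hc u hu
        unfold phi at this
        exact (mul_eq_zero.1 this).resolve_left (amp_pos V E θ u).ne'
      have h4 : HasDerivWithinAt (fun u => Real.sin (θ u)) 0 (Ici u₀) u₀ :=
        (hasDerivWithinAt_const u₀ (Ici u₀) (0:ℝ)).congr (fun u hu => h3 u hu) (h3 u₀ le_rfl)
      have h5 := (h u₀).sin.hasDerivWithinAt (s := Ici u₀)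
      have h6 := (uniqueDiffWithinAt_Ici u₀).eq_deriv _ h4 h5
      rw [h3 u₀ le_rfl] at h6
      have e := Real.sin_sq_add_cos_sq (θ u₀)
      rw [h3 u₀ le_rfl] at e
      simp at h6
      rw [← h6] at e
      norm_num at e
    · intro u _
      rw [hd, (dphi_deriv hV h u).deriv]; ring
    · rw [hd]; unfold phi dphi
      rw [h0, Real.sin_neg, Real.cos_neg]; ring

end Morse9

namespace Morse9

open Set Filter Topology MeasureTheory

lemma not_integrable_of_ge {f : ℝ → ℝ} {a d : ℝ} (hd : 0 < d) (h : ∀ u, a ≤ u → d ≤ f u)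
    (hf : IntegrableOn f (Ici a)) : False := by
  have h1 : IntegrableOn (fun _ : ℝ => d) (Ici a) := by
    refine Integrable.mono' hf aestronglyMeasurable_const ?_
    refine (ae_restrict_mem measurableSet_Ici).mono fun u hu => ?_
    rw [Real.norm_of_nonneg hd.le]
    exact h u hu
  rw [integrableOn_const_iff] at h1
  rcases h1 with h1 | h1
  · simp at h1; exact hd.ne' h1
  · simp at h1

lemma phi_cont {V θ : ℝ → ℝ} {E : ℝ} (hV : Continuous V) (h : IsPr V E θ) :
    Continuous (phi V E θ) :=
  continuous_iff_continuousAt.2 fun u => (phi_deriv hV h u).continuousAt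

lemma dphi_cont {V θ : ℝ → ℝ} {E : ℝ} (hV : Continuous V) (h : IsPr V E θ) :
    Continuous (dphi V E θ) :=
  continuous_iff_continuousAt.2 fun u => (dphi_deriv hV h u).continuousAt

lemma prod_deriv {V θ : ℝ → ℝ} {E : ℝ} (hV : Continuous V) (h : IsPr V E θ) (u : ℝ) :
    HasDerivAt (fun u => phi V E θ u * dphi V E θ u)
      (dphi V E θ u ^ 2 + (V u - E) * phi V E θ u ^ 2) u :=
  ((phi_deriv hV h u).mul (dphi_deriv hV h u)).congr_deriv (by ring)

lemma decay_int {V θ : ℝ → ℝ} {E u₀ b : ℝ} (hV : Continuous V) (h : IsPr V E θ)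
    (hVtop : Tendsto V atTop atTop)
    (hle : ∀ u, b ≤ u → phi V E θ u * dphi V E θ u ≤ 0) :
    IntegrableOn (fun u => phi V E θ u ^ 2) (Ici u₀) := by
  have hc := phi_cont hV h
  have hc2 := dphi_cont hV h
  obtain ⟨c, hcE⟩ := eventually_atTop.1 (hVtop.eventually_ge_atTop (E + 1))
  set b' := max (max b c) u₀
  have hb1 : b ≤ b' := (le_max_left _ _).trans (le_max_left _ _)
  have hb2 : c ≤ b' := (le_max_right _ _).trans (le_max_left _ _)
  have hb3 : u₀ ≤ b' := le_max_right _ _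
  have hsqInt : IntegrableOn (fun u => phi V E θ u ^ 2) (Ioi b') := by
    refine integrableOn_Ioi_of_intervalIntegral_norm_bounded (l := atTop) (b := id)
      (-(phi V E θ b' * dphi V E θ b')) b' ?_ tendsto_id ?_
    · intro i
      exact (by fun_prop : Continuous fun u => phi V E θ u ^ 2).integrableOn_Ioc
    · filter_upwards [eventually_ge_atTop b'] with i hi
      simp only [id]
      have h1 : ∫ x in b'..i, ‖phi V E θ x ^ 2‖ ≤
          ∫ x in b'..i, (dphi V E θ x ^ 2 + (V x - E) * phi V E θ x ^ 2) := by
        apply intervalIntegral.integral_mono_on hi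
        · exact (by fun_prop : Continuous fun u => ‖phi V E θ u ^ 2‖).intervalIntegrable _ _
        · exact (by fun_prop : Continuous fun x =>
            (dphi V E θ x ^ 2 + (V x - E) * phi V E θ x ^ 2)).intervalIntegrable _ _
        · intro x hx
          rw [Real.norm_of_nonneg (sq_nonneg _)]
          have := hcE x (hb2.trans hx.1)
          nlinarith [sq_nonneg (dphi V E θ x), sq_nonneg (phi V E θ x)]
      have h2 := intervalIntegral.integral_eq_sub_of_hasDerivAt (a := b') (b := i)
        (fun x _ => prod_deriv hV h x) ((by fun_prop : Continuous fun x =>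
            (dphi V E θ x ^ 2 + (V x - E) * phi V E θ x ^ 2)).intervalIntegrable _ _)
      have h3 := hle i (hb1.trans hi)
      linarith
  have : Ici u₀ = Icc u₀ b' ∪ Ioi b' := (Icc_union_Ioi_eq_Ici hb3).symm
  rw [this]
  exact ((by fun_prop : Continuous fun u => phi V E θ u ^ 2).continuousOn.integrableOn_Icc).union
    hsqInt

lemma grow_not_int {V θ : ℝ → ℝ} {E u₀ b u₁ : ℝ} (hV : Continuous V) (h : IsPr V E θ)
    (hub : u₀ ≤ b) (hE : ∀ u, b ≤ u → E < V u) (hu₁ : b ≤ u₁)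
    (hge : 0 ≤ phi V E θ u₁ * dphi V E θ u₁)
    (hsqInt : IntegrableOn (fun u => phi V E θ u ^ 2) (Ici u₀)) : False := by
  have hmono : StrictMonoOn (fun u => phi V E θ u * dphi V E θ u) (Ici u₁) := by
    apply strictMonoOn_of_deriv_pos (convex_Ici u₁)
    · exact fun u _ => (prod_deriv hV h u).continuousAt.continuousWithinAt
    · intro u hu
      rw [(prod_deriv hV h u).deriv]
      have hu' : u₁ ≤ u := interior_subset hu
      have hVE := hE u (hu₁.trans hu')
      have hA := amp_pos V E θ u
      have e := Real.sin_sq_add_cos_sq (θ u)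
      unfold phi dphi
      have : (amp V E θ u * Real.cos (θ u)) ^ 2 + (V u - E) * (amp V E θ u * Real.sin (θ u)) ^ 2 =
        amp V E θ u ^ 2 * (Real.cos (θ u) ^ 2 + (V u - E) * Real.sin (θ u) ^ 2) := by ring
      rw [this]
      apply mul_pos (by positivity)
      rcases eq_or_ne (Real.sin (θ u)) 0 with h0 | h0
      · rw [h0] at e ⊢; nlinarith
      · have : 0 < Real.sin (θ u) ^ 2 := by positivity
        have := mul_pos (sub_pos.2 hVE) this
        nlinarith [sq_nonneg (Real.cos (θ u))]
  have hpos : ∀ u, u₁ + 1 ≤ u → 0 < phi V E θ u * dphi V E θ u := by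
    intro u hu
    have := hmono (self_mem_Ici : u₁ ∈ Ici u₁) (mem_Ici.2 (by linarith : u₁ ≤ u)) (by linarith)
    simp only at this
    linarith
  have hmono2 : MonotoneOn (fun u => phi V E θ u ^ 2) (Ici (u₁ + 1)) := by
    have hd : ∀ u, HasDerivAt (fun u => phi V E θ u ^ 2) (2 * (phi V E θ u * dphi V E θ u)) u :=
      fun u => ((phi_deriv hV h u).pow 2).congr_deriv (by simp; ring)
    apply monotoneOn_of_deriv_nonneg (convex_Ici _)
    · exact fun u _ => (hd u).continuousAt.continuousWithinAt
    · exact fun u _ => (hd u).differentiableAt.differentiableWithinAt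
    · intro u hu
      rw [(hd u).deriv]
      have := hpos u (interior_subset hu)
      linarith
  have hne : phi V E θ (u₁ + 1) ≠ 0 := by
    intro h0
    have := hpos (u₁ + 1) le_rfl
    rw [h0] at this; simp at this
  have hsub : IntegrableOn (fun u => phi V E θ u ^ 2) (Ici (u₁ + 1)) :=
    hsqInt.mono_set (Ici_subset_Ici.2 (by linarith))
  exact not_integrable_of_ge (by positivity : 0 < phi V E θ (u₁ + 1) ^ 2)
    (fun u hu => hmono2 (mem_Ici.2 le_rfl) (mem_Ici.2 hu) hu) hsub

lemma phi_mul_dphi (V : ℝ → ℝ) (E : ℝ) (θ : ℝ → ℝ) (u : ℝ) :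
    phi V E θ u * dphi V E θ u = amp V E θ u ^ 2 / 2 * Real.sin (2 * θ u) := by
  unfold phi dphi; rw [Real.sin_two_mul]; ring

lemma sin_two_shift (x : ℝ) (j : ℤ) : Real.sin (2 * (x - j * Real.pi)) = Real.sin (2 * x) := by
  have : 2 * (x - j * Real.pi) = 2 * x - j * (2 * Real.pi) := by ring
  rw [this, Real.sin_sub_int_mul_two_pi]

lemma eigen_angle {V θ : ℝ → ℝ} {E u₀ b : ℝ} (hV : Continuous V) (h : IsPr V E θ)
    (hub : u₀ ≤ b) (hE : ∀ u, b ≤ u → E < V u)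
    (hsqInt : IntegrableOn (fun u => phi V E θ u ^ 2) (Ici u₀)) {u : ℝ} (hu : b ≤ u) :
    ⌊θ b / Real.pi⌋ * Real.pi + Real.pi / 2 < θ u ∧
      θ u < ⌊θ b / Real.pi⌋ * Real.pi + Real.pi := by
  have hpi := Real.pi_pos
  have hneg : ∀ u, b ≤ u → Real.sin (2 * θ u) < 0 := by
    intro v hv
    by_contra hc
    push Not at hc
    refine grow_not_int hV h hub hE hv ?_ hsqInt
    rw [phi_mul_dphi]
    positivity
  set j := ⌊θ b / Real.pi⌋ with hj
  have h1 : (j : ℝ) * Real.pi ≤ θ b := by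
    have := Int.floor_le (θ b / Real.pi)
    rwa [le_div_iff₀ hpi] at this
  have h2 : θ b < j * Real.pi + Real.pi := by
    have := Int.lt_floor_add_one (θ b / Real.pi)
    rw [div_lt_iff₀ hpi] at this
    linarith
  have h3 := h.barrier_low hV j h1 hu
  have h4 : θ u < j * Real.pi + Real.pi := by
    by_contra hc
    push Not at hc
    obtain ⟨w, hw, hw2⟩ := intermediate_value_Icc hu (h.continuous.continuousOn)
      (show j * Real.pi + Real.pi ∈ Icc (θ b) (θ u) from ⟨h2.le, hc⟩)
    have := hneg w hw.1
    rw [← sin_two_shift _ j, hw2] at this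
    simp at this
  refine ⟨?_, h4⟩
  by_contra hc
  push Not at hc
  have := hneg u hu
  rw [← sin_two_shift _ j] at this
  have h5 : 0 ≤ Real.sin (2 * (θ u - j * Real.pi)) :=
    Real.sin_nonneg_of_nonneg_of_le_pi (by linarith) (by linarith)
  linarith

lemma eigen_inj {V θ θ' : ℝ → ℝ} {E E' u₀ b : ℝ} (hV : Continuous V) (h : IsPr V E θ)
    (h' : IsPr V E' θ') (hub : u₀ ≤ b) (hEE : E < E') (h0 : θ u₀ = θ' u₀)
    (hE : ∀ u, b ≤ u → E' < V u)
    (hsqInt : IntegrableOn (fun u => phi V E θ u ^ 2) (Ici u₀))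
    (hsqInt' : IntegrableOn (fun u => phi V E' θ' u ^ 2) (Ici u₀))
    (hj : ⌊θ b / Real.pi⌋ = ⌊θ' b / Real.pi⌋) : False := by
  have hpi := Real.pi_pos
  have ha := fun u (hu : b ≤ u) => eigen_angle hV h hub (fun u hu => hEE.trans (hE u hu)) hsqInt hu
  have ha' := fun u (hu : b ≤ u) => eigen_angle hV h' hub hE hsqInt' hu
  rw [← hj] at ha'
  set j := ⌊θ b / Real.pi⌋ with hj
  set W : ℝ → ℝ := fun u => phi V E θ u * dphi V E' θ' u - dphi V E θ u * phi V E' θ' u with hW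
  have hWs : ∀ u, W u = amp V E θ u * amp V E' θ' u * Real.sin (θ u - θ' u) := by
    intro u; simp only [hW, phi, dphi]; rw [Real.sin_sub]; ring
  have hWd : ∀ u, HasDerivAt W ((E - E') * (phi V E θ u * phi V E' θ' u)) u := fun u =>
    (((phi_deriv hV h u).mul (dphi_deriv hV h' u)).sub
      ((dphi_deriv hV h u).mul (phi_deriv hV h' u))).congr_deriv (by ring)
  have hpp : ∀ u, b ≤ u → 0 < phi V E θ u * phi V E' θ' u := by
    intro u hu
    have e : phi V E θ u * phi V E' θ' u = amp V E θ u * amp V E' θ' u *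
        (Real.sin (θ u) * Real.sin (θ' u)) := by unfold phi; ring
    have e2 : Real.sin (θ u) * Real.sin (θ' u) =
        Real.sin (θ u - j * Real.pi) * Real.sin (θ' u - j * Real.pi) := by
      rw [Real.sin_sub_int_mul_pi, Real.sin_sub_int_mul_pi]
      have : ((-1:ℝ) ^ j) * ((-1:ℝ) ^ j) = 1 := by
        rw [← mul_zpow]; norm_num
      linear_combination (-(Real.sin (θ u) * Real.sin (θ' u))) * this
    rw [e, e2]
    have h1 := ha u hu
    have h2 := ha' u hu
    have h3 := Real.sin_pos_of_pos_of_lt_pi (x := θ u - j * Real.pi) (by linarith) (by linarith)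
    have h4 := Real.sin_pos_of_pos_of_lt_pi (x := θ' u - j * Real.pi) (by linarith) (by linarith)
    have := amp_pos V E θ u
    have := amp_pos V E' θ' u
    positivity
  have hWb : W b ≤ 0 := by
    rw [hWs]
    have h1 := ha b le_rfl
    have h2 := ha' b le_rfl
    have h3 := h.mono hV h' hEE.le h0.le hub
    have h4 : Real.sin (θ b - θ' b) ≤ 0 :=
      Real.sin_nonpos_of_nonpos_of_neg_pi_le (by linarith) (by linarith)
    have := amp_pos V E θ b
    have := amp_pos V E' θ' b
    exact mul_nonpos_of_nonneg_of_nonpos (by positivity) h4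
  have hWanti : StrictAntiOn W (Ici b) := by
    apply strictAntiOn_of_deriv_neg (convex_Ici b)
    · exact fun u _ => (hWd u).continuousAt.continuousWithinAt
    · intro u hu
      rw [(hWd u).deriv]
      exact mul_neg_of_neg_of_pos (by linarith) (hpp u (interior_subset hu))
  have hW1 : W (b + 1) < 0 :=
    (hWanti (mem_Ici.2 le_rfl) (mem_Ici.2 (by linarith)) (by linarith)).trans_le hWb
  -- derivative squares are decreasing
  have hanti : ∀ {F : ℝ} {ϑ : ℝ → ℝ} (_ : IsPr V F ϑ) (_ : ∀ u, b ≤ u → F < V u)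
      (_ : ∀ u, b ≤ u → j * Real.pi + Real.pi / 2 < ϑ u ∧ ϑ u < j * Real.pi + Real.pi),
      ∀ u, b ≤ u → dphi V F ϑ u ^ 2 ≤ dphi V F ϑ b ^ 2 := by
    intro F ϑ hF hFV hFa u hu
    have hd : ∀ u, HasDerivAt (fun u => dphi V F ϑ u ^ 2)
        (2 * (V u - F) * (phi V F ϑ u * dphi V F ϑ u)) u :=
      fun u => ((dphi_deriv hV hF u).pow 2).congr_deriv (by simp; ring)
    have : AntitoneOn (fun u => dphi V F ϑ u ^ 2) (Ici b) := by
      apply antitoneOn_of_deriv_nonpos (convex_Ici b)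
      · exact fun u _ => (hd u).continuousAt.continuousWithinAt
      · exact fun u _ => (hd u).differentiableAt.differentiableWithinAt
      · intro u hu
        have hu' : b ≤ u := interior_subset hu
        rw [(hd u).deriv, phi_mul_dphi, ← sin_two_shift _ j]
        have h1 := hFa u hu'
        have h2 : Real.sin (2 * (ϑ u - j * Real.pi)) ≤ 0 := by
          rw [← Real.sin_sub_two_pi]
          exact Real.sin_nonpos_of_nonpos_of_neg_pi_le (by linarith) (by linarith)
        have h3 := hFV u hu'
        apply mul_nonpos_of_nonneg_of_nonpos (by linarith)
        apply mul_nonpos_of_nonneg_of_nonpos (by positivity) h2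
    exact this (mem_Ici.2 le_rfl) (mem_Ici.2 hu) hu
  have hb1 := hanti h (fun u hu => hEE.trans (hE u hu)) ha
  have hb2 := hanti h' hE ha'
  set M := dphi V E θ b ^ 2 + dphi V E' θ' b ^ 2 + 1
  have hM : 0 < M := by positivity
  have hs : IntegrableOn (fun u => phi V E θ u ^ 2 + phi V E' θ' u ^ 2) (Ici (b + 1)) :=
    (hsqInt.add hsqInt').mono_set (Ici_subset_Ici.2 (by linarith))
  refine not_integrable_of_ge (d := W (b + 1) ^ 2 / (2 * M)) (by have := hW1.ne; positivity)
    (fun u hu => ?_) hs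
  have hu' : b ≤ u := by linarith
  rw [div_le_iff₀ (by positivity)]
  have h1 : W u ≤ W (b + 1) := hWanti.antitoneOn (mem_Ici.2 (by linarith)) (mem_Ici.2 hu') hu
  have h2 : W (b + 1) ^ 2 ≤ W u ^ 2 := by nlinarith
  refine h2.trans ?_
  have h3 := hb1 u hu'
  have h4 := hb2 u hu'
  simp only [hW]
  set p := phi V E θ u
  set q := phi V E' θ' u
  set x := dphi V E θ u
  set y := dphi V E' θ' u
  have h5 : (p * y - x * q) ^ 2 ≤ 2 * (p ^ 2 * y ^ 2 + x ^ 2 * q ^ 2) := by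
    nlinarith [sq_nonneg (p * y + x * q)]
  have h6 : p ^ 2 * y ^ 2 ≤ p ^ 2 * M := by
    apply mul_le_mul_of_nonneg_left _ (sq_nonneg _)
    simp only [M]; nlinarith [sq_nonneg (dphi V E θ b)]
  have h7 : x ^ 2 * q ^ 2 ≤ M * q ^ 2 := by
    apply mul_le_mul_of_nonneg_right _ (sq_nonneg _)
    simp only [M]; nlinarith [sq_nonneg (dphi V E' θ' b)]
  nlinarith

lemma eigen_exists {V : ℝ → ℝ} (hV : Continuous V) (hVtop : Tendsto V atTop atTop)
    {Θ : ℝ → ℝ → ℝ} (h : ∀ E, IsPr V E (Θ E)) {u₀ θ₀ b E₁ T : ℝ} (h0 : ∀ E, Θ E u₀ = θ₀)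
    (hθ₀ : θ₀ ≤ 0) (hub : u₀ ≤ b) (hE₁ : ∀ u, u₀ ≤ u → E₁ ≤ V u) (hT : ∀ u, b ≤ u → T ≤ V u)
    (hE₁T : E₁ ≤ T) (j : ℤ) (hj : 1 ≤ j) (hjT : j * Real.pi + Real.pi < Θ T b) :
    ∃ E, E < T ∧ IntegrableOn (fun u => phi V E (Θ E) u ^ 2) (Ici u₀) ∧
      j * Real.pi + Real.pi / 2 ≤ Θ E b ∧ Θ E b ≤ j * Real.pi + Real.pi := by
  have hpi := Real.pi_pos
  set D : Set ℝ := ⋃ u ∈ Ici b, {E | Θ E u < j * Real.pi + Real.pi / 2}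
  set U : Set ℝ := ⋃ u ∈ Ici b, {E | j * Real.pi + Real.pi < Θ E u}
  have hD : IsOpen D := isOpen_biUnion fun u hu =>
    isOpen_lt (cont_E hV h h0 (hub.trans hu)) continuous_const
  have hU : IsOpen U := isOpen_biUnion fun u hu =>
    isOpen_lt continuous_const (cont_E hV h h0 (hub.trans hu))
  have hjr : (1 : ℝ) ≤ j := by exact_mod_cast hj
  have hE₁D : E₁ ∈ D := by
    refine mem_biUnion (mem_Ici.2 le_rfl) ?_
    have := (h E₁).barrier_up hV 0 hE₁ (by rw [h0]; simp; linarith) hub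
    simp only [Int.cast_zero, zero_mul, zero_add] at this
    simp only [mem_setOf_eq]
    nlinarith
  have hTU : T ∈ U := mem_biUnion (mem_Ici.2 le_rfl) hjT
  have hnot : ¬ (Icc E₁ T ⊆ D ∪ U) := by
    intro hsub
    obtain ⟨E, hE, hED, hEU⟩ := isPreconnected_Icc D U hD hU hsub
      ⟨E₁, left_mem_Icc.2 hE₁T, hE₁D⟩ ⟨T, right_mem_Icc.2 hE₁T, hTU⟩
    simp only [D, U, mem_iUnion, mem_setOf_eq, mem_Ici] at hED hEU
    obtain ⟨u, hu, hu2⟩ := hED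
    obtain ⟨w, hw, hw2⟩ := hEU
    have h1 := (h E).barrier_up hV j (fun v hv => hE.2.trans (hT v (hu.trans hv))) hu2.le
      (le_max_left u w)
    have h2 := (h E).barrier_low hV (j + 1) (by push_cast; linarith) (le_max_right u w)
    push_cast at h2
    linarith
  rw [not_subset] at hnot
  obtain ⟨E, hE, hEn⟩ := hnot
  simp only [D, U, mem_union, mem_iUnion, mem_setOf_eq, mem_Ici, not_or, not_exists, not_lt] at hEn
  refine ⟨E, ?_, ?_, hEn.1 b le_rfl, hEn.2 b le_rfl⟩
  · rcases lt_or_eq_of_le hE.2 with h1 | h1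
    · exact h1
    · subst h1
      have := hEn.2 b le_rfl
      linarith
  · refine decay_int hV (h E) hVtop (b := b) fun u hu => ?_
    rw [phi_mul_dphi, ← sin_two_shift _ j]
    have h1 := hEn.1 u hu
    have h2 := hEn.2 u hu
    apply mul_nonpos_of_nonneg_of_nonpos (by positivity)
    rw [← Real.sin_sub_two_pi]
    exact Real.sin_nonpos_of_nonpos_of_neg_pi_le (by linarith) (by linarith)

lemma count {V : ℝ → ℝ} (hV : Continuous V) (hVtop : Tendsto V atTop atTop)
    {Θ : ℝ → ℝ → ℝ} (h : ∀ E, IsPr V E (Θ E)) {u₀ α b E₁ T : ℝ} (h0 : ∀ E, Θ E u₀ = -α)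
    (hα0 : 0 ≤ α) (hα1 : α < 2 * Real.pi)
    (hub : u₀ ≤ b) (hE₁ : ∀ u, u₀ ≤ u → E₁ ≤ V u) (hT : ∀ u, b ≤ u → T ≤ V u)
    (hE₁T : E₁ ≤ T) :
    (evSet α u₀ V ∩ Iio T).Finite ∧
      |((evSet α u₀ V ∩ Iio T).ncard : ℝ) - Θ T b / Real.pi| ≤ 5 := by
  have hpi := Real.pi_pos
  set S := evSet α u₀ V ∩ Iio T with hS
  have hmem : ∀ E, E ∈ S ↔ IntegrableOn (fun u => phi V E (Θ E) u ^ 2) (Ici u₀) ∧ E < T := by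
    intro E
    rw [hS, mem_inter_iff, ev_iff hV (h E) (h0 E), mem_Iio]
  have hmaps : ∀ E ∈ S, ⌊Θ E b / Real.pi⌋ ∈ Icc (-2) ⌊Θ T b / Real.pi⌋ := by
    intro E hE
    rw [hmem] at hE
    constructor
    · rw [Int.le_floor, le_div_iff₀ hpi]
      exact (h E).barrier_low hV (-2) (by rw [h0]; push_cast; linarith) hub
    · apply Int.floor_le_floor
      apply div_le_div_of_nonneg_right _ hpi.le
      exact (h E).mono hV (h T) hE.2.le (by rw [h0, h0]) hub
  have hinj : InjOn (fun E => ⌊Θ E b / Real.pi⌋) S := by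
    have key : ∀ E ∈ S, ∀ E' ∈ S, E < E' → ⌊Θ E b / Real.pi⌋ = ⌊Θ E' b / Real.pi⌋ → False := by
      intro E hE E' hE' hlt heq
      rw [hmem] at hE hE'
      exact eigen_inj hV (h E) (h E') hub hlt (by rw [h0, h0])
        (fun u hu => hE'.2.trans_le (hT u hu)) hE.1 hE'.1 heq
    intro E hE E' hE' heq
    rcases lt_trichotomy E E' with hl | hl | hl
    · exact (key E hE E' hE' hl heq).elim
    · exact hl
    · exact (key E' hE' E hE hl heq.symm).elim
  have hfin : S.Finite := Set.Finite.of_finite_image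
    ((Set.finite_Icc (-2) ⌊Θ T b / Real.pi⌋).subset (image_subset_iff.2 hmaps)) hinj
  refine ⟨hfin, ?_⟩
  have hθT : -2 ≤ Θ T b / Real.pi := by
    rw [le_div_iff₀ hpi]
    have := (h T).barrier_low hV (-2) (by rw [h0]; push_cast; linarith) hub
    push_cast at this; exact this
  have hfl1 := Int.floor_le (Θ T b / Real.pi)
  have hfl2 := Int.lt_floor_add_one (Θ T b / Real.pi)
  have hup : (S.ncard : ℝ) ≤ Θ T b / Real.pi + 3 := by
    have h1 := ncard_le_ncard_of_injOn _ hmaps hinj (Set.finite_Icc _ _)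
    have h2 : (Icc (-2) ⌊Θ T b / Real.pi⌋).ncard = (⌊Θ T b / Real.pi⌋ + 1 - (-2)).toNat := by
      rw [← Int.card_Icc, ← Set.ncard_coe_finset, Finset.coe_Icc]
    rw [h2] at h1
    have h3 : -2 ≤ ⌊Θ T b / Real.pi⌋ := by rw [Int.le_floor]; exact_mod_cast hθT
    have h4 : (S.ncard : ℤ) ≤ ⌊Θ T b / Real.pi⌋ + 1 - (-2) := by omega
    have h5 : (S.ncard : ℝ) ≤ ((⌊Θ T b / Real.pi⌋ + 1 - (-2) : ℤ) : ℝ) := by exact_mod_cast h4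
    push_cast at h5
    linarith
  have hlow : Θ T b / Real.pi - 5 ≤ (S.ncard : ℝ) := by
    set n : ℕ := (⌊Θ T b / Real.pi⌋ - 3).toNat with hn
    have hex : ∀ i : ℕ, i < n → ∃ E, E < T ∧
        IntegrableOn (fun u => phi V E (Θ E) u ^ 2) (Ici u₀) ∧
        ((i + 1 : ℤ) : ℝ) * Real.pi + Real.pi / 2 ≤ Θ E b ∧
          Θ E b ≤ ((i + 1 : ℤ) : ℝ) * Real.pi + Real.pi := by
      intro i hi
      refine eigen_exists hV hVtop h h0 (by linarith) hub hE₁ hT hE₁T (i + 1) (by omega) ?_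
      have h1 : ((i : ℤ) + 3 : ℤ) < ⌊Θ T b / Real.pi⌋ := by omega
      have h2 : (((i : ℤ) + 3 : ℤ) : ℝ) < Θ T b / Real.pi :=
        lt_of_lt_of_le (by exact_mod_cast h1) hfl1
      rw [lt_div_iff₀ hpi] at h2
      push_cast at h2 ⊢
      linarith
    choose! e he1 he2 he3 he4 using hex
    have hn' := le_ncard_of_inj_on_range (s := S) (n := n) e
      (fun i hi => (hmem _).2 ⟨he2 i hi, he1 i hi⟩) (by
        have key : ∀ i < n, ∀ j < n, i < j → e i = e j → False := by
          intro i hi j hj hij heq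
          have h1 := he4 i hi
          have h2 := he3 j hj
          rw [heq] at h1
          have h3 : (i : ℝ) + 1 ≤ j := by exact_mod_cast hij
          push_cast at h1 h2
          nlinarith
        intro i hi j hj heq
        rcases lt_trichotomy i j with hl | hl | hl
        · exact (key i hi j hj hl heq).elim
        · exact hl
        · exact (key j hj i hi hl heq.symm).elim) hfin
    have h3 : ⌊Θ T b / Real.pi⌋ - 3 ≤ (S.ncard : ℤ) := by omega
    have h4 : ((⌊Θ T b / Real.pi⌋ - 3 : ℤ) : ℝ) ≤ (S.ncard : ℝ) := by exact_mod_cast h3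
    push_cast at h4
    linarith
  rw [abs_le]
  constructor <;> linarith

end Morse9

namespace Morse9

open Set Filter Topology MeasureTheory

lemma abs_sub_le_of_deriv {f g f' g' : ℝ → ℝ} {a b : ℝ} (hab : a ≤ b)
    (hfc : ContinuousOn f (Icc a b)) (hgc : ContinuousOn g (Icc a b))
    (hf : ∀ u ∈ Ioo a b, HasDerivAt f (f' u) u) (hg : ∀ u ∈ Ioo a b, HasDerivAt g (g' u) u)
    (h : ∀ u ∈ Ioo a b, |f' u| ≤ g' u) : |f b - f a| ≤ g b - g a := by
  have h1 : MonotoneOn (fun u => g u - f u) (Icc a b) := by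
    apply monotoneOn_of_deriv_nonneg (convex_Icc a b) (hgc.sub hfc)
    · rw [interior_Icc]
      exact fun u hu => ((hg u hu).sub (hf u hu)).differentiableAt.differentiableWithinAt
    · rw [interior_Icc]
      intro u hu
      rw [((hg u hu).sub (hf u hu)).deriv]
      linarith [(abs_le.1 (h u hu)).2]
  have h2 : MonotoneOn (fun u => g u + f u) (Icc a b) := by
    apply monotoneOn_of_deriv_nonneg (convex_Icc a b) (hgc.add hfc)
    · rw [interior_Icc]
      exact fun u hu => ((hg u hu).add (hf u hu)).differentiableAt.differentiableWithinAt
    · rw [interior_Icc]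
      intro u hu
      rw [((hg u hu).add (hf u hu)).deriv]
      linarith [(abs_le.1 (h u hu)).1]
  have h3 := h1 (left_mem_Icc.2 hab) (right_mem_Icc.2 hab) hab
  have h4 := h2 (left_mem_Icc.2 hab) (right_mem_Icc.2 hab) hab
  simp only at h3 h4
  rw [abs_le]; constructor <;> linarith

/-- Modified Prüfer angle: `tan η = ω tan θ`. -/
noncomputable def eta (ω θ : ℝ) : ℝ :=
  θ + Real.arctan ((ω - 1) * (Real.sin θ * Real.cos θ) / (Real.cos θ ^ 2 + ω * Real.sin θ ^ 2))

lemma eta_sub (ω θ : ℝ) : |eta ω θ - θ| ≤ Real.pi / 2 := by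
  unfold eta
  rw [add_sub_cancel_left, abs_le]
  exact ⟨(Real.neg_pi_div_two_lt_arctan _).le, (Real.arctan_lt_pi_div_two _).le⟩

lemma den_pos {ω : ℝ} (hω : 0 < ω) (θ : ℝ) : 0 < Real.cos θ ^ 2 + ω * Real.sin θ ^ 2 := by
  have e := Real.sin_sq_add_cos_sq θ
  rcases eq_or_ne (Real.sin θ) 0 with h | h
  · rw [h] at e ⊢; nlinarith
  · have : 0 < Real.sin θ ^ 2 := by positivity
    positivity

lemma eta_deriv {ω θ : ℝ → ℝ} {ω' θ' u : ℝ} (hω : HasDerivAt ω ω' u) (hθ : HasDerivAt θ θ' u)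
    (hpos : 0 < ω u) : HasDerivAt (fun u => eta (ω u) (θ u))
      ((ω u * θ' + ω' * (Real.sin (θ u) * Real.cos (θ u))) /
        (Real.cos (θ u) ^ 2 + ω u ^ 2 * Real.sin (θ u) ^ 2)) u := by
  have hD := den_pos hpos (θ u)
  have hD2 := den_pos (pow_pos hpos 2) (θ u)
  have h1 := ((hω.sub_const 1).mul (hθ.sin.mul hθ.cos)).div
    ((hθ.cos.pow 2).add (hω.mul (hθ.sin.pow 2))) hD.ne'
  have h2 := hθ.add h1.arctan
  refine h2.congr_deriv ?_
  simp only [Pi.mul_apply, Pi.add_apply, Pi.pow_apply, Pi.div_apply]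
  have e := Real.sin_sq_add_cos_sq (θ u)
  set s := Real.sin (θ u)
  set c := Real.cos (θ u)
  set w := ω u
  have key : 1 + ((w - 1) * (s * c) / (c ^ 2 + w * s ^ 2)) ^ 2 =
      (c ^ 2 + w ^ 2 * s ^ 2) / (c ^ 2 + w * s ^ 2) ^ 2 := by
    rw [div_pow, eq_div_iff (by positivity), add_mul, div_mul_cancel₀ _ (by positivity)]
    linear_combination (c ^ 2 + w ^ 2 * s ^ 2) * e
  rw [key]
  field_simp
  have e4 : c ^ 2 = 1 - s ^ 2 := by linarith
  have e3 : c ^ 3 = c * (1 - s ^ 2) := by rw [← e4]; ring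
  have e5 : c ^ 4 = (1 - s ^ 2) ^ 2 := by rw [← e4]; ring
  ring_nf
  simp only [e3, e4, e5]
  ring

lemma q_deriv {ω θ : ℝ → ℝ} {ω' θ' u : ℝ} (hω : HasDerivAt ω ω' u) (hθ : HasDerivAt θ θ' u)
    (hpos : 0 < ω u) : HasDerivAt (fun u => (Real.cos (θ u) ^ 2 - ω u ^ 2 * Real.sin (θ u) ^ 2) /
        (Real.cos (θ u) ^ 2 + ω u ^ 2 * Real.sin (θ u) ^ 2))
      (-2 * (2 * ω u * (Real.sin (θ u) * Real.cos (θ u)) /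
        (Real.cos (θ u) ^ 2 + ω u ^ 2 * Real.sin (θ u) ^ 2)) *
      ((ω u * θ' + ω' * (Real.sin (θ u) * Real.cos (θ u))) /
        (Real.cos (θ u) ^ 2 + ω u ^ 2 * Real.sin (θ u) ^ 2))) u := by
  have hD2 := den_pos (pow_pos hpos 2) (θ u)
  have h1 := ((hθ.cos.pow 2).sub ((hω.pow 2).mul (hθ.sin.pow 2))).div
    ((hθ.cos.pow 2).add ((hω.pow 2).mul (hθ.sin.pow 2))) hD2.ne'
  refine h1.congr_deriv ?_
  simp only [Pi.mul_apply, Pi.add_apply, Pi.pow_apply, Pi.sub_apply]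
  have e := Real.sin_sq_add_cos_sq (θ u)
  set s := Real.sin (θ u)
  set c := Real.cos (θ u)
  set w := ω u
  field_simp
  push_cast
  have e4 : c ^ 2 = 1 - s ^ 2 := by linarith
  have e3 : c ^ 3 = c * (1 - s ^ 2) := by rw [← e4]; ring
  ring_nf
  simp only [e3, e4]
  ring

/-- The variable `x = exp u / 2`. -/
noncomputable def X (u : ℝ) : ℝ := Real.exp u / 2

lemma X_pos (u : ℝ) : 0 < X u := by unfold X; positivity
lemma X_deriv (u : ℝ) : HasDerivAt X (X u) u := (Real.hasDerivAt_exp u).div_const 2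
lemma X_cont : Continuous X := by unfold X; fun_prop
lemma X_mono {u v : ℝ} (h : u ≤ v) : X u ≤ X v := by unfold X; gcongr

lemma morse_eq (k u : ℝ) : morse k u = X u ^ 2 + 2 * k * X u := by
  unfold morse X
  rw [show 2 * u = u + u by ring, Real.exp_add]; ring

lemma morse_cont (k : ℝ) : Continuous (morse k) := by unfold morse; fun_prop

/-- First derivative of the potential. -/
noncomputable def V1 (k u : ℝ) : ℝ := 2 * X u ^ 2 + 2 * k * X u

/-- Second derivative of the potential. -/
noncomputable def V2 (k u : ℝ) : ℝ := 4 * X u ^ 2 + 2 * k * X u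

lemma morse_deriv (k u : ℝ) : HasDerivAt (morse k) (V1 k u) u := by
  have : morse k = fun u => X u ^ 2 + 2 * k * X u := funext (morse_eq k)
  rw [this]
  refine (((X_deriv u).pow 2).add ((X_deriv u).const_mul (2 * k))).congr_deriv ?_
  unfold V1; simp; ring

lemma V1_deriv (k u : ℝ) : HasDerivAt (V1 k) (V2 k u) u := by
  refine ((((X_deriv u).pow 2).const_mul 2).add ((X_deriv u).const_mul (2 * k))).congr_deriv ?_
  unfold V2; simp; ring

lemma V1_cont (k : ℝ) : Continuous (V1 k) := by
  have := X_cont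
  unfold V1; fun_prop

/-- Local momentum. -/
noncomputable def om (k T u : ℝ) : ℝ := Real.sqrt (T - morse k u)

lemma om_cont (k T : ℝ) : Continuous (om k T) := by
  have := morse_cont k
  unfold om; fun_prop

lemma om_deriv {k T u : ℝ} (h : morse k u < T) :
    HasDerivAt (om k T) (-V1 k u / (2 * om k T u)) u :=
  ((morse_deriv k u).const_sub T).sqrt (by linarith)

lemma om_pos {k T u : ℝ} (h : morse k u < T) : 0 < om k T u := Real.sqrt_pos.2 (by linarith)

lemma om_sq {k T u : ℝ} (h : morse k u ≤ T) : om k T u ^ 2 = T - morse k u :=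
  Real.sq_sqrt (by linarith)

/-- Approximate phase. -/
noncomputable def G (k T u : ℝ) : ℝ :=
  om k T u - Real.sqrt T * Real.log (Real.sqrt T + om k T u) + Real.sqrt T * (u - Real.log 2)

lemma om_nonneg (k T u : ℝ) : 0 ≤ om k T u := Real.sqrt_nonneg _

lemma G_cont {k T : ℝ} (hT : 0 < T) : Continuous (G k T) := by
  have h1 := om_cont k T
  have h2 := Real.sqrt_pos.2 hT
  have h3 : ∀ u, Real.sqrt T + om k T u ≠ 0 := fun u => by
    have := om_nonneg k T u
    positivity
  unfold G
  have : Continuous fun u => Real.log (Real.sqrt T + om k T u) :=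
    Continuous.log (by fun_prop) h3
  fun_prop

lemma G_deriv {k T u : ℝ} (hT : 0 < T) (h : morse k u < T) :
    HasDerivAt (G k T) (om k T u + k * X u / (Real.sqrt T + om k T u)) u := by
  have hA := Real.sqrt_pos.2 hT
  have hA2 := Real.sq_sqrt hT.le
  have hw := om_pos h
  have hw2 := om_sq h.le
  have h1 := om_deriv h
  have h2 := ((h1.const_add (Real.sqrt T)).log (by positivity)).const_mul (Real.sqrt T)
  have h3 := ((hasDerivAt_id u).sub_const (Real.log 2)).const_mul (Real.sqrt T)
  refine ((h1.sub h2).add h3).congr_deriv ?_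
  rw [morse_eq] at hw2
  set A := Real.sqrt T
  set w := om k T u
  unfold V1
  field_simp
  have hTe : A ^ 2 = w ^ 2 + (X u ^ 2 + 2 * k * X u) := by rw [hA2, hw2]; ring
  linear_combination w * hTe

lemma eta_om_deriv {k T u : ℝ} {θ : ℝ → ℝ} (hθ : IsPr (morse k) T θ) (h : morse k u < T) :
    HasDerivAt (fun u => eta (om k T u) (θ u))
      (om k T u - V1 k u / (4 * om k T u ^ 2) *
        (2 * om k T u * (Real.sin (θ u) * Real.cos (θ u)) /
        (Real.cos (θ u) ^ 2 + om k T u ^ 2 * Real.sin (θ u) ^ 2))) u := by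
  have hw := om_pos h
  have hw2 := om_sq h.le
  have hD2 := den_pos (pow_pos hw 2) (θ u)
  refine (eta_deriv (om_deriv h) (hθ u) hw).congr_deriv ?_
  rw [← hw2]
  have e := Real.sin_sq_add_cos_sq (θ u)
  set s := Real.sin (θ u)
  set c := Real.cos (θ u)
  set w := om k T u
  have : 1 + (w ^ 2 - 1) * s ^ 2 = c ^ 2 + w ^ 2 * s ^ 2 := by linear_combination (-1) * e
  rw [this]
  field_simp
  ring

lemma abs_p_le {w : ℝ} (hw : 0 < w) (θ : ℝ) :
    |2 * w * (Real.sin θ * Real.cos θ) / (Real.cos θ ^ 2 + w ^ 2 * Real.sin θ ^ 2)| ≤ 1 := by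
  have hD2 := den_pos (pow_pos hw 2) θ
  rw [abs_div, abs_of_pos hD2, div_le_one hD2, abs_le]
  constructor
  · nlinarith [sq_nonneg (Real.cos θ + w * Real.sin θ)]
  · nlinarith [sq_nonneg (Real.cos θ - w * Real.sin θ)]

lemma abs_q_le {w : ℝ} (hw : 0 < w) (θ : ℝ) :
    |(Real.cos θ ^ 2 - w ^ 2 * Real.sin θ ^ 2) / (Real.cos θ ^ 2 + w ^ 2 * Real.sin θ ^ 2)| ≤ 1 := by
  have hD2 := den_pos (pow_pos hw 2) θ
  rw [abs_div, abs_of_pos hD2, div_le_one hD2, abs_le]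
  have := sq_nonneg (w * Real.sin θ)
  constructor <;> nlinarith [sq_nonneg (Real.cos θ)]

lemma kX_le {k T u : ℝ} (hT : 0 < T) :
    |k * X u / (Real.sqrt T + om k T u)| ≤ |k| * X u / Real.sqrt T := by
  have hA := Real.sqrt_pos.2 hT
  have hw := om_nonneg k T u
  have hX := X_pos u
  rw [abs_div, abs_mul, abs_of_pos hX, abs_of_pos (by positivity : 0 < Real.sqrt T + om k T u)]
  gcongr
  linarith

/-- Part I: a fixed interval. -/
lemma part1 {k T u₀ c M : ℝ} {θ : ℝ → ℝ} (hθ : IsPr (morse k) T θ) (huc : u₀ ≤ c) (hT : 1 ≤ T)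
    (hV : ∀ u ∈ Icc u₀ c, morse k u + 1 ≤ T) (hM : ∀ u ∈ Icc u₀ c, |V1 k u| ≤ M) :
    |(eta (om k T c) (θ c) - G k T c) - (eta (om k T u₀) (θ u₀) - G k T u₀)| ≤
      (M / 4 + |k| * X c) * (c - u₀) := by
  have hT0 : 0 < T := by linarith
  have hA : 1 ≤ Real.sqrt T := Real.one_le_sqrt.2 hT
  have hd : ∀ u ∈ Icc u₀ c, HasDerivAt (fun u => eta (om k T u) (θ u) - G k T u)
      ((om k T u - V1 k u / (4 * om k T u ^ 2) *
        (2 * om k T u * (Real.sin (θ u) * Real.cos (θ u)) /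
        (Real.cos (θ u) ^ 2 + om k T u ^ 2 * Real.sin (θ u) ^ 2))) -
        (om k T u + k * X u / (Real.sqrt T + om k T u))) u := fun u hu =>
    (eta_om_deriv hθ (by linarith [hV u hu])).sub (G_deriv hT0 (by linarith [hV u hu]))
  have := abs_sub_le_of_deriv (g := fun u => (M / 4 + |k| * X c) * u)
    (g' := fun _ => (M / 4 + |k| * X c)) huc
    (fun u hu => (hd u hu).continuousAt.continuousWithinAt) (by fun_prop)
    (fun u hu => hd u (Ioo_subset_Icc_self hu))
    (fun u _ => by simpa using (hasDerivAt_id u).const_mul (M / 4 + |k| * X c)) (by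
      intro u hu
      have hu' := Ioo_subset_Icc_self hu
      have h1 := hV u hu'
      have hw2 := om_sq (k := k) (T := T) (u := u) (by linarith)
      have hw := om_pos (k := k) (T := T) (u := u) (by linarith)
      have hp := abs_p_le hw (θ u)
      have hk := kX_le (k := k) (u := u) hT0
      have hk2 : |k| * X u / Real.sqrt T ≤ |k| * X c := by
        rw [div_le_iff₀ (by linarith)]
        have h1 : |k| * X u ≤ |k| * X c :=
          mul_le_mul_of_nonneg_left (X_mono hu'.2) (abs_nonneg k)
        have h2 : 0 ≤ |k| * X c := mul_nonneg (abs_nonneg k) (X_pos c).le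
        nlinarith
      have hV1 : |V1 k u / (4 * om k T u ^ 2)| ≤ M / 4 := by
        rw [abs_div, abs_of_pos (by positivity : 0 < 4 * om k T u ^ 2), div_le_div_iff₀
          (by positivity) (by norm_num)]
        have := hM u hu'
        have h3 := abs_nonneg (V1 k u)
        nlinarith
      set p := 2 * om k T u * (Real.sin (θ u) * Real.cos (θ u)) /
        (Real.cos (θ u) ^ 2 + om k T u ^ 2 * Real.sin (θ u) ^ 2)
      have h5 : |V1 k u / (4 * om k T u ^ 2) * p| ≤ M / 4 := by
        rw [abs_mul]
        nlinarith [abs_nonneg (V1 k u / (4 * om k T u ^ 2)), abs_nonneg p]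
      rw [abs_le] at *
      constructor <;> linarith [hk.1, hk.2, h5.1, h5.2])
  simpa [mul_sub] using this

/-- Part II: up to the Airy region. -/
lemma part2 {k T c u₁ : ℝ} {θ : ℝ → ℝ} (hθ : IsPr (morse k) T θ) (hcu : c ≤ u₁) (hT : 0 < T)
    (hV : ∀ u ∈ Icc c u₁, morse k u < T) (hV1 : ∀ u ∈ Icc c u₁, 0 ≤ V1 k u)
    (hV2 : ∀ u ∈ Icc c u₁, 0 ≤ V2 k u) (h1 : V1 k u₁ = om k T u₁ ^ 3)
    (hc1 : V1 k c ≤ om k T c ^ 3) :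
    |(eta (om k T u₁) (θ u₁) - G k T u₁) - (eta (om k T c) (θ c) - G k T c)| ≤
      1 + |k| * X u₁ / Real.sqrt T := by
  set e : ℝ → ℝ := fun u => V1 k u / (4 * om k T u ^ 3) with he
  set q : ℝ → ℝ := fun u => (Real.cos (θ u) ^ 2 - om k T u ^ 2 * Real.sin (θ u) ^ 2) /
        (Real.cos (θ u) ^ 2 + om k T u ^ 2 * Real.sin (θ u) ^ 2) with hq
  set p : ℝ → ℝ := fun u => 2 * om k T u * (Real.sin (θ u) * Real.cos (θ u)) /
        (Real.cos (θ u) ^ 2 + om k T u ^ 2 * Real.sin (θ u) ^ 2) with hp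
  set e' : ℝ → ℝ := fun u => V2 k u / (4 * om k T u ^ 3) + 3 * V1 k u ^ 2 / (8 * om k T u ^ 5)
    with he'
  have hA := Real.sqrt_pos.2 hT
  have hed : ∀ u ∈ Icc c u₁, HasDerivAt e (e' u) u := by
    intro u hu
    have hw := om_pos (hV u hu)
    have hne : 4 * om k T u ^ 3 ≠ 0 := by positivity
    refine ((V1_deriv k u).div (((om_deriv (hV u hu)).pow 3).const_mul 4) hne).congr_deriv ?_
    simp only [he', Pi.pow_apply]
    field_simp
    push_cast
    ring
  have hηd : ∀ u ∈ Icc c u₁, HasDerivAt (fun u => eta (om k T u) (θ u))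
      (om k T u * (1 - e u * p u)) u := by
    intro u hu
    have hw := om_pos (hV u hu)
    refine (eta_om_deriv hθ (hV u hu)).congr_deriv ?_
    change om k T u - V1 k u / (4 * om k T u ^ 2) * p u = _
    simp only [he]
    field_simp
  have hqd : ∀ u ∈ Icc c u₁, HasDerivAt q (-2 * p u * (om k T u * (1 - e u * p u))) u := by
    intro u hu
    have hw := om_pos (hV u hu)
    have h2 := q_deriv (om_deriv (hV u hu)) (hθ u) hw
    have h3 := (eta_deriv (om_deriv (hV u hu)) (hθ u) hw).unique (hηd u hu)
    rw [h3] at h2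
    exact h2
  have hfd : ∀ u ∈ Icc c u₁, HasDerivAt
      (fun u => eta (om k T u) (θ u) - (1 / 2) * (e u * q u) - G k T u)
      (-(1 / 2) * e' u * q u - e u ^ 2 * om k T u * p u ^ 2
        - k * X u / (Real.sqrt T + om k T u)) u := by
    intro u hu
    refine (((hηd u hu).sub (((hed u hu).mul (hqd u hu)).const_mul (1 / 2))).sub
      (G_deriv hT (hV u hu))).congr_deriv ?_
    ring
  have hgd : ∀ u ∈ Icc c u₁, HasDerivAt (fun u => (2 / 3) * e u + |k| / Real.sqrt T * X u)
      ((2 / 3) * e' u + |k| / Real.sqrt T * X u) u := fun u hu =>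
    ((hed u hu).const_mul _).add ((X_deriv u).const_mul _)
  have key := abs_sub_le_of_deriv hcu
    (fun u hu => (hfd u hu).continuousAt.continuousWithinAt)
    (fun u hu => (hgd u hu).continuousAt.continuousWithinAt)
    (fun u hu => hfd u (Ioo_subset_Icc_self hu)) (fun u hu => hgd u (Ioo_subset_Icc_self hu)) (by
      intro u hu
      have hu' := Ioo_subset_Icc_self hu
      have hw := om_pos (hV u hu')
      have hk := kX_le (k := k) (u := u) hT
      have hqq : |q u| ≤ 1 := abs_q_le hw (θ u)
      have hpp : |p u| ≤ 1 := abs_p_le hw (θ u)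
      have hv2 := hV2 u hu'
      have he2 : e u ^ 2 * om k T u ≤ e' u / 6 := by
        have : e u ^ 2 * om k T u = (3 * V1 k u ^ 2 / (8 * om k T u ^ 5)) / 6 := by
          simp only [he]; field_simp; ring
        rw [this]
        have : 0 ≤ V2 k u / (4 * om k T u ^ 3) := by positivity
        simp only [he']
        linarith
      have he0 : 0 ≤ e u ^ 2 * om k T u := by positivity
      have he'0 : 0 ≤ e' u := by linarith
      have h3 : |(1 / 2) * e' u * q u| ≤ e' u / 2 := by
        rw [abs_mul, abs_of_nonneg (by positivity)]
        nlinarith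
      have h4 : p u ^ 2 ≤ 1 := by
        rw [← sq_abs]; nlinarith [abs_nonneg (p u)]
      have h5 : e u ^ 2 * om k T u * p u ^ 2 ≤ e' u / 6 := by nlinarith
      have h6 : 0 ≤ e u ^ 2 * om k T u * p u ^ 2 := by positivity
      have h7 : |k| * X u / Real.sqrt T = |k| / Real.sqrt T * X u := by ring
      rw [h7] at hk
      rw [abs_le] at h3 hk ⊢
      constructor <;> linarith [h3.1, h3.2, hk.1, hk.2])
  have hcm := left_mem_Icc.2 hcu
  have hum := right_mem_Icc.2 hcu
  have hwc := om_pos (hV c hcm)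
  have hwu := om_pos (hV u₁ hum)
  have heu : e u₁ = 1 / 4 := by simp only [he]; rw [h1]; field_simp
  have hec : e c ≤ 1 / 4 := by
    simp only [he]; rw [div_le_iff₀ (by positivity)]; linarith
  have hec0 : 0 ≤ e c := by
    have := hV1 c hcm
    simp only [he]; positivity
  have hqu : |q u₁| ≤ 1 := abs_q_le hwu (θ u₁)
  have hqc : |q c| ≤ 1 := abs_q_le hwc (θ c)
  have hXc : 0 ≤ |k| / Real.sqrt T * X c := by
    have := X_pos c
    positivity
  have h8 : |k| * X u₁ / Real.sqrt T = |k| / Real.sqrt T * X u₁ := by ring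
  rw [h8]
  rw [heu] at key
  have h9 : |e c * q c| ≤ 1 / 4 := by
    rw [abs_mul, abs_of_nonneg hec0]; nlinarith [abs_nonneg (q c)]
  rw [abs_le] at *
  constructor <;> linarith [key.1, key.2, hqu.1, hqu.2, h9.1, h9.2]

/-- Part III: the Airy region. -/
lemma part3 {k T u₁ b : ℝ} {θ : ℝ → ℝ} (hθ : IsPr (morse k) T θ) (hub : u₁ ≤ b) (hT : 0 < T)
    (hV : ∀ u ∈ Ico u₁ b, morse k u < T) (hb : morse k b = T) (hu : morse k u₁ < T)
    (hV1 : ∀ u ∈ Icc u₁ b, V1 k u₁ ≤ V1 k u) (h1 : V1 k u₁ = om k T u₁ ^ 3) :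
    |eta (om k T u₁) (θ b) - eta (om k T u₁) (θ u₁)| ≤ 1 ∧
    |G k T b - G k T u₁| ≤ 1 + |k| * X b / Real.sqrt T := by
  have hw := om_pos hu
  have hw2 := om_sq hu.le
  have hA := Real.sqrt_pos.2 hT
  set w := om k T u₁ with hwdef
  have hL : w * (b - u₁) ≤ 1 := by
    have := abs_sub_le_of_deriv (f := fun u => w ^ 3 * u) (f' := fun _ => w ^ 3)
      (g := morse k) (g' := V1 k) hub (by fun_prop) (morse_cont k).continuousOn
      (fun u _ => by simpa using (hasDerivAt_id u).const_mul (w ^ 3))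
      (fun u _ => morse_deriv k u) (fun u hu => by
        rw [abs_of_nonneg (by positivity), ← h1]
        exact hV1 u (Ioo_subset_Icc_self hu))
    rw [hb, ← hw2] at this
    have h2 := le_trans (le_abs_self _) this
    have h3 : w ^ 2 * (w * (b - u₁)) ≤ w ^ 2 * 1 := by linarith
    exact le_of_mul_le_mul_left h3 (by positivity)
  have hom : ∀ u ∈ Ioo u₁ b, 0 ≤ T - morse k u ∧ T - morse k u ≤ w ^ 2 := by
    intro u hu
    refine ⟨by linarith [hV u ⟨hu.1.le, hu.2⟩], ?_⟩
    rw [hw2]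
    have hm : MonotoneOn (morse k) (Icc u₁ b) := by
      apply monotoneOn_of_deriv_nonneg (convex_Icc _ _) (morse_cont k).continuousOn
      · exact fun u _ => (morse_deriv k u).differentiableAt.differentiableWithinAt
      · intro u hu
        rw [(morse_deriv k u).deriv]
        have := hV1 u (interior_subset hu)
        have h3 : 0 < w ^ 3 := by positivity
        linarith
    have := hm (left_mem_Icc.2 hub) (Ioo_subset_Icc_self hu) hu.1.le
    linarith
  constructor
  · have hd : ∀ u, HasDerivAt (fun u => eta w (θ u)) _ u := fun u =>
      eta_deriv (ω := fun _ => w) (hasDerivAt_const u w) (hθ u) hw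
    have := abs_sub_le_of_deriv (g := fun u => w * u) (g' := fun _ => w) hub
      (fun u hu => (hd u).continuousAt.continuousWithinAt) (by fun_prop)
      (fun u _ => hd u) (fun u _ => by simpa using (hasDerivAt_id u).const_mul w) (by
        intro u hu
        have hD := den_pos (pow_pos hw 2) (θ u)
        obtain ⟨h3, h4⟩ := hom u hu
        have e := Real.sin_sq_add_cos_sq (θ u)
        have e2 : 1 + (T - morse k u - 1) * Real.sin (θ u) ^ 2 =
          Real.cos (θ u) ^ 2 + (T - morse k u) * Real.sin (θ u) ^ 2 := by linear_combination -e
        rw [e2, zero_mul, add_zero, abs_of_nonneg (by positivity), div_le_iff₀ hD]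
        apply mul_le_mul_of_nonneg_left _ hw.le
        have := mul_le_mul_of_nonneg_right h4 (sq_nonneg (Real.sin (θ u)))
        linarith)
    rw [← mul_sub] at this
    exact this.trans hL
  · have := abs_sub_le_of_deriv (f := G k T) (g := fun u => w * u + |k| / Real.sqrt T * X u)
      (g' := fun u => w + |k| / Real.sqrt T * X u) hub
      (G_cont hT).continuousOn (by have := X_cont; fun_prop)
      (fun u hu => G_deriv hT (hV u ⟨hu.1.le, hu.2⟩))
      (fun u _ => (((hasDerivAt_id u).const_mul w).add
        ((X_deriv u).const_mul (|k| / Real.sqrt T))).congr_deriv (by simp))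
      (by
        intro u hu
        have hk := kX_le (k := k) (u := u) hT
        have h7 : |k| * X u / Real.sqrt T = |k| / Real.sqrt T * X u := by ring
        rw [h7] at hk
        have h3 := om_nonneg k T u
        have h4 : om k T u ≤ w := by
          apply Real.sqrt_le_sqrt
          have := (hom u hu).2
          rw [hw2] at this
          linarith
        have h5 : |om k T u| = om k T u := abs_of_nonneg h3
        exact (abs_add_le _ _).trans (by linarith))
    have hX : 0 ≤ |k| / Real.sqrt T * X u₁ := by
      have := X_pos u₁
      positivity
    have h8 : |k| * X b / Real.sqrt T = |k| / Real.sqrt T * X b := by ring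
    rw [h8]
    linarith

end Morse9

namespace Morse9

open Set Filter Topology MeasureTheory

lemma log_sub_bounds {x y : ℝ} (hx : 0 < x) (hy : 0 < y) :
    (x - y) / x ≤ Real.log x - Real.log y ∧ Real.log x - Real.log y ≤ (x - y) / y := by
  rw [← Real.log_div hx.ne' hy.ne']
  have h := div_pos hx hy
  have h1 := Real.log_le_sub_one_of_pos h
  have h2 := Real.one_sub_inv_le_log_of_pos h
  have e1 : (x - y) / x = 1 - (x / y)⁻¹ := by field_simp
  have e2 : (x - y) / y = x / y - 1 := by field_simp
  rw [e1, e2]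
  exact ⟨h2, h1⟩

lemma G_b {k T b : ℝ} (hT : 0 < T) (hb : morse k b = T) (hX : 4 * |k| ≤ X b) :
    |G k T b| ≤ 4 * |k| ∧ X b ≤ 2 * Real.sqrt T := by
  have hA := Real.sqrt_pos.2 hT
  have hA2 := Real.sq_sqrt hT.le
  have hx := X_pos b
  have hom : om k T b = 0 := by unfold om; rw [hb, sub_self, Real.sqrt_zero]
  have hlog : b - Real.log 2 = Real.log (X b) := by
    unfold X
    rw [Real.log_div (Real.exp_pos b).ne' (by norm_num), Real.log_exp]
  have hG : G k T b = Real.sqrt T * (Real.log (X b) - Real.log (Real.sqrt T)) := by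
    unfold G; rw [hom, hlog]; ring
  rw [morse_eq, ← hA2] at hb
  rw [hG]
  set A := Real.sqrt T
  set x := X b
  obtain ⟨l1, l2⟩ := log_sub_bounds hx hA
  have hk1 := neg_abs_le k
  have hk2 := le_abs_self k
  have hk0 := abs_nonneg k
  have hkx : |k * x| = |k| * x := by rw [abs_mul, abs_of_pos hx]
  have hkx1 := neg_abs_le (k * x)
  have hkx2 := le_abs_self (k * x)
  rw [hkx] at hkx1 hkx2
  have hxA : x ≤ 2 * A := by
    by_contra hc
    push Not at hc
    nlinarith
  have hAx : A ≤ 2 * x := by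
    by_contra hc
    push Not at hc
    nlinarith
  have hd1 : x - A ≤ 2 * |k| := by
    by_contra hc
    push Not at hc
    nlinarith
  have hd2 : A - x ≤ 2 * |k| := by
    by_contra hc
    push Not at hc
    nlinarith
  refine ⟨?_, hxA⟩
  rw [abs_le]
  constructor
  · have h1 : A * ((x - A) / x) ≤ A * (Real.log x - Real.log A) :=
      mul_le_mul_of_nonneg_left l1 hA.le
    have h2 : -(4 * |k|) ≤ A * ((x - A) / x) := by
      rw [← mul_div_assoc, le_div_iff₀ hx]
      nlinarith
    linarith
  · have h1 : A * (Real.log x - Real.log A) ≤ A * ((x - A) / A) :=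
      mul_le_mul_of_nonneg_left l2 hA.le
    rw [mul_div_cancel₀ _ hA.ne'] at h1
    linarith

lemma G_u0 {k T u : ℝ} (hT : 1 ≤ T) (hV : morse k u ≤ T) :
    |G k T u - (Real.sqrt T - Real.sqrt T * Real.log (2 * Real.sqrt T)
      + Real.sqrt T * (u - Real.log 2))| ≤ 2 * |morse k u| := by
  have hA : 1 ≤ Real.sqrt T := Real.one_le_sqrt.2 hT
  have hA2 := Real.sq_sqrt (by linarith : 0 ≤ T)
  have hw := om_nonneg k T u
  have hw2 : om k T u ^ 2 = Real.sqrt T ^ 2 - morse k u := by rw [hA2]; exact om_sq hV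
  unfold G
  set A := Real.sqrt T
  set w := om k T u
  set v := morse k u
  obtain ⟨l1, l2⟩ := log_sub_bounds (x := A + w) (y := 2 * A) (by linarith) (by linarith)
  have hv1 := neg_abs_le v
  have hv2 := le_abs_self v
  have hwa : |w - A| ≤ |v| := by
    have : |w - A| * (w + A) = |v| := by
      rw [← abs_of_nonneg (by linarith : 0 ≤ w + A), ← abs_mul, ← abs_neg v]
      congr 1
      linear_combination hw2
    nlinarith [abs_nonneg (w - A)]
  have h0 := abs_nonneg (w - A)
  have hwa1 := neg_abs_le (w - A)
  have hwa2 := le_abs_self (w - A)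
  have h1 : A * ((A + w - 2 * A) / (A + w)) ≤ A * (Real.log (A + w) - Real.log (2 * A)) :=
    mul_le_mul_of_nonneg_left l1 (by linarith)
  have h2 : A * (Real.log (A + w) - Real.log (2 * A)) ≤ A * ((A + w - 2 * A) / (2 * A)) :=
    mul_le_mul_of_nonneg_left l2 (by linarith)
  have h3 : -|w - A| ≤ A * ((A + w - 2 * A) / (A + w)) := by
    rw [← mul_div_assoc, le_div_iff₀ (by linarith)]
    nlinarith
  have h4 : A * ((A + w - 2 * A) / (2 * A)) ≤ |w - A| := by
    rw [← mul_div_assoc, div_le_iff₀ (by linarith)]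
    nlinarith
  rw [abs_le]
  constructor <;> nlinarith

lemma morse_tendsto (k : ℝ) : Tendsto (morse k) atTop atTop := by
  have hX : Tendsto X atTop atTop := by
    unfold X
    exact Real.tendsto_exp_atTop.atTop_div_const (by norm_num)
  refine tendsto_atTop_mono' atTop ?_ hX
  filter_upwards [hX.eventually_ge_atTop (2 * |k| + 1)] with u hu
  rw [morse_eq]
  have := neg_abs_le k
  have := X_pos u
  nlinarith

lemma V1_ge {k u v : ℝ} (hX : 4 * |k| + 1 ≤ X u) (huv : u ≤ v) :
    0 < V1 k u ∧ V1 k u ≤ V1 k v ∧ 0 ≤ V2 k u := by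
  have h1 := neg_abs_le k
  have h0 := abs_nonneg k
  have h2 := X_pos u
  have h3 := X_mono huv
  unfold V1 V2
  refine ⟨by nlinarith, ?_, by nlinarith⟩
  nlinarith [mul_nonneg (sub_nonneg.2 h3) (by linarith : 0 ≤ X u + X v + k)]

lemma morse_strict {k u v c : ℝ} (hX : 4 * |k| + 1 ≤ X c) (hcu : c ≤ u) (huv : u < v) :
    morse k u < morse k v := by
  have hs : StrictMonoOn (morse k) (Ici c) := by
    apply strictMonoOn_of_deriv_pos (convex_Ici c) (morse_cont k).continuousOn
    intro x hx
    rw [interior_Ici] at hx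
    rw [(morse_deriv k x).deriv]
    have hx' : c ≤ x := le_of_lt hx
    exact (V1_ge (hX.trans (X_mono hx')) le_rfl).1
  exact hs hcu (hcu.trans huv.le) huv

/-- The phase at the turning point. -/
lemma phase {k T u₀ c M : ℝ} {θ : ℝ → ℝ} (hθ : IsPr (morse k) T θ) (huc : u₀ ≤ c)
    (hX : 4 * |k| + 1 ≤ X c) (hT : 1 ≤ T) (hM0 : ∀ u ∈ Icc u₀ c, |morse k u| ≤ M)
    (hM1 : ∀ u ∈ Icc u₀ c, |V1 k u| ≤ M) (hTM : 2 * M + 1 ≤ T) :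
    ∃ b, c ≤ b ∧ (∀ u, b ≤ u → T ≤ morse k u) ∧
      |θ b - θ u₀ - (Real.sqrt T * Real.log (2 * Real.sqrt T) - Real.sqrt T
        - Real.sqrt T * (u₀ - Real.log 2))| ≤
      (M / 4 + |k| * X c) * (c - u₀) + 20 + 20 * |k| + 2 * M := by
  have hT0 : 0 < T := by linarith
  have hM : 0 ≤ M := (abs_nonneg _).trans (hM0 c (right_mem_Icc.2 huc))
  have hVc := hM0 c (right_mem_Icc.2 huc)
  have hV1c := hM1 c (right_mem_Icc.2 huc)
  have hmc : morse k c + M + 1 ≤ T := by linarith [le_abs_self (morse k c)]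
  obtain ⟨b, hcb, hb⟩ : ∃ b, c ≤ b ∧ morse k b = T := by
    obtain ⟨d, hd⟩ := ((morse_tendsto k).eventually_ge_atTop T).and (eventually_ge_atTop c) |>.exists
    obtain ⟨b, hb, hbT⟩ := intermediate_value_Icc hd.2 (morse_cont k).continuousOn
      (⟨by linarith, hd.1⟩ : T ∈ Icc (morse k c) (morse k d))
    exact ⟨b, hb.1, hbT⟩
  have hlt : ∀ u, c ≤ u → u < b → morse k u < T := fun u h1 h2 => hb ▸ morse_strict hX h1 h2
  have hXc : ∀ u, c ≤ u → 4 * |k| + 1 ≤ X u := fun u h => hX.trans (X_mono h)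
  have homb : om k T b = 0 := by unfold om; rw [hb, sub_self, Real.sqrt_zero]
  have hwc2 := om_sq (k := k) (T := T) (u := c) (by linarith)
  have hwc0 := om_nonneg k T c
  have hwc1 : 1 ≤ om k T c := by nlinarith
  have hwc3 : V1 k c ≤ om k T c ^ 3 := by
    have := le_abs_self (V1 k c)
    have h2 : om k T c ^ 2 ≤ om k T c ^ 3 := pow_le_pow_right₀ hwc1 (by norm_num)
    linarith
  obtain ⟨u₁, hu₁, h1⟩ : ∃ u₁ ∈ Icc c b, V1 k u₁ = om k T u₁ ^ 3 := by
    have hc : Continuous fun u => V1 k u - om k T u ^ 3 := by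
      have := V1_cont k
      have := om_cont k T
      fun_prop
    obtain ⟨u₁, h, h'⟩ := intermediate_value_Icc hcb hc.continuousOn
      (⟨by linarith, by rw [homb]; simpa using (V1_ge (hXc b hcb) le_rfl).1.le⟩ :
        (0:ℝ) ∈ Icc (V1 k c - om k T c ^ 3) (V1 k b - om k T b ^ 3))
    exact ⟨u₁, h, by simp only at h'; linarith⟩
  have hu₁b : u₁ < b := by
    rcases hu₁.2.lt_or_eq with h | h
    · exact h
    · exfalso
      have h2 := (V1_ge (hXc b hcb) le_rfl).1
      rw [h, homb] at h1
      norm_num at h1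
      linarith
  refine ⟨b, hcb, ?_, ?_⟩
  · intro u hu
    rcases hu.lt_or_eq with h | h
    · rw [← hb]; exact (morse_strict hX hcb h).le
    · rw [← h, hb]
  have p1 := part1 hθ huc hT (fun u hu => by linarith [hM0 u hu, le_abs_self (morse k u)]) hM1
  have p2 := part2 hθ hu₁.1 hT0 (fun u hu => hlt u hu.1 (hu.2.trans_lt hu₁b))
    (fun u hu => (V1_ge (hXc u hu.1) le_rfl).1.le) (fun u hu => (V1_ge (hXc u hu.1) le_rfl).2.2)
    h1 hwc3
  obtain ⟨p3, p4⟩ := part3 hθ hu₁.2 hT0 (fun u hu => hlt u (hu₁.1.trans hu.1) hu.2) hb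
    (hlt u₁ hu₁.1 hu₁b) (fun u hu => (V1_ge (hXc u₁ hu₁.1) hu.1).2.1) h1
  obtain ⟨g1, g2⟩ := G_b hT0 hb (by linarith [hXc b hcb])
  have hm0 := hM0 u₀ (left_mem_Icc.2 huc)
  have g3 := G_u0 (k := k) (u := u₀) hT (by linarith [le_abs_self (morse k u₀)])
  have s1 := eta_sub (om k T u₁) (θ b)
  have s2 := eta_sub (om k T u₀) (θ u₀)
  have hA := Real.sqrt_pos.2 hT0
  have hpi := Real.pi_le_four
  have hkb : |k| * X b / Real.sqrt T ≤ 2 * |k| := by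
    rw [div_le_iff₀ hA]
    nlinarith [abs_nonneg k]
  have hku : |k| * X u₁ / Real.sqrt T ≤ 2 * |k| := by
    rw [div_le_iff₀ hA]
    nlinarith [abs_nonneg k, X_mono hu₁.2]
  have hk0 := abs_nonneg k
  rw [abs_le] at p1 p2 p3 p4 g1 g3 s1 s2 ⊢
  constructor <;> linarith [p1.1, p2.1, p3.1, p4.1, g1.1, g3.1, s1.1, s2.1,
    p1.2, p2.2, p3.2, p4.2, g1.2, g3.2, s1.2, s2.2]

end Morse9

/-- Eigenvalue counting asymptotics for the Morse potential on `[u₀,∞)`: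
`N(T) = (1/(2π))·√T·log T + (1/π)·(2 log 2 - 1 - u₀)·√T + O(1)`. -/
theorem stmt_9 (k u₀ α : ℝ) (hα0 : 0 ≤ α) (hα1 : α < 2 * Real.pi) :
    ∃ T₁ C : ℝ, 0 < C ∧ ∀ T : ℝ, T₁ ≤ T →
      (evSet α u₀ (morse k) ∩ Set.Iio T).Finite ∧
      |((evSet α u₀ (morse k) ∩ Set.Iio T).ncard : ℝ) -
        ((1/(2*Real.pi)) * Real.sqrt T * Real.log T +
         (1/Real.pi) * (2*Real.log 2 - 1 - u₀) * Real.sqrt T)| ≤ C := by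
  obtain ⟨c, huc, hX⟩ : ∃ c, u₀ ≤ c ∧ 4 * |k| + 1 ≤ Morse9.X c := by
    refine ⟨max u₀ (Real.log (2 * (4 * |k| + 1))), le_max_left _ _, ?_⟩
    refine le_trans ?_ (Morse9.X_mono (le_max_right _ _))
    unfold Morse9.X
    rw [Real.exp_log (by positivity)]
    linarith
  obtain ⟨M0, hM0⟩ := (isCompact_Icc (a := u₀) (b := c)).exists_bound_of_continuousOn
    (Morse9.morse_cont k).continuousOn
  obtain ⟨M1, hM1⟩ := (isCompact_Icc (a := u₀) (b := c)).exists_bound_of_continuousOn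
    (Morse9.V1_cont k).continuousOn
  set M := max M0 M1 with hMdef
  have hM0' : ∀ u ∈ Set.Icc u₀ c, |morse k u| ≤ M := fun u hu => (hM0 u hu).trans (le_max_left _ _)
  have hM1' : ∀ u ∈ Set.Icc u₀ c, |Morse9.V1 k u| ≤ M :=
    fun u hu => (hM1 u hu).trans (le_max_right _ _)
  have hM : 0 ≤ M := (abs_nonneg _).trans (hM0' c (Set.right_mem_Icc.2 huc))
  set B := (M / 4 + |k| * Morse9.X c) * (c - u₀) + 20 + 20 * |k| + 2 * M with hB
  have hB0 : 0 ≤ B := by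
    have := Morse9.X_pos c
    have := sub_nonneg.2 huc
    positivity
  have hpi := Real.pi_pos
  refine ⟨2 * M + 1, 5 + (B + 2 * Real.pi) / Real.pi, by positivity, ?_⟩
  intro T hT
  choose Θ hΘ0 hΘ using fun E : ℝ => Morse9.prufer_exists (fun u => E - morse k u)
    (continuous_const.sub (Morse9.morse_cont k)) u₀ (-α)
  have hPr : ∀ E, Morse9.IsPr (morse k) E (Θ E) := hΘ
  obtain ⟨b, hcb, hbT, hph⟩ := Morse9.phase (hPr T) huc hX (by linarith) hM0' hM1' hT
  obtain ⟨hfin, hcnt⟩ := Morse9.count (Morse9.morse_cont k) (Morse9.morse_tendsto k) hPr hΘ0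
    hα0 hα1 (huc.trans hcb) (E₁ := -k ^ 2) (T := T)
    (fun u _ => by rw [Morse9.morse_eq]; nlinarith [sq_nonneg (Morse9.X u + k)]) hbT
    (by nlinarith [sq_nonneg k])
  refine ⟨hfin, ?_⟩
  rw [hΘ0] at hph
  have hT0 : 0 < T := by linarith
  have hA := Real.sqrt_pos.2 hT0
  have hlogT : Real.log T = 2 * Real.log (Real.sqrt T) := by
    rw [Real.log_sqrt hT0.le]; ring
  rw [Real.log_mul (by norm_num) hA.ne'] at hph
  set A := Real.sqrt T
  set N := ((evSet α u₀ (morse k) ∩ Set.Iio T).ncard : ℝ)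
  rw [hlogT]
  have e : (1/(2*Real.pi)) * A * (2 * Real.log A) + (1/Real.pi) * (2*Real.log 2 - 1 - u₀) * A =
      (A * (Real.log 2 + Real.log A) - A - A * (u₀ - Real.log 2)) / Real.pi := by
    field_simp
    ring
  rw [e]
  set P := A * (Real.log 2 + Real.log A) - A - A * (u₀ - Real.log 2)
  have h1 : |Θ T b / Real.pi - P / Real.pi| ≤ (B + 2 * Real.pi) / Real.pi := by
    rw [← sub_div, abs_div, abs_of_pos hpi]
    apply div_le_div_of_nonneg_right _ hpi.le
    rw [abs_le] at hph ⊢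
    constructor <;> linarith [hph.1, hph.2]
  exact (abs_sub_le N (Θ T b / Real.pi) _).trans (add_le_add hcnt h1)
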